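/- arXiv:1209.6096 — 2 statements merged into one kernel-verified Lean document; each statement's English description precedes it below -/
import Mathlib

section
/- Let W ⊆ ℂ be a bounded, open, connected, simply connected set and w ∈ W. If ∂W, with its subspace topology from ℂ, is locally connected, then for every fundamental chain (γ_j) in (W,w) the intersection ⋂_j closure(N_{γ_j}) consists of a single point; equivalently, diam N_{γ_j} → 0 as j → ∞. -/
/-- A crosscut of `W`: a continuous injective map `γ : [0,1] → ℂ` with
`γ(t) ∈ W` for `t ∈ (0,1)` and endpoints on `∂W`. -/
def IsCrosscut (W : Set ℂ) (γ : ℝ → ℂ) : Prop :=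
  ContinuousOn γ (Set.Icc 0 1) ∧ Set.InjOn γ (Set.Icc 0 1) ∧
    (∀ t ∈ Set.Ioo (0:ℝ) 1, γ t ∈ W) ∧ γ 0 ∈ frontier W ∧ γ 1 ∈ frontier W

/-- The crosscut neighborhood `N_γ`: the union of the connected components of
`W \ γ((0,1))` which do not contain the base point `w`. -/
def crosscutNbhd (W : Set ℂ) (w : ℂ) (γ : ℝ → ℂ) : Set ℂ :=
  {z | z ∈ W \ γ '' Set.Ioo 0 1 ∧ w ∉ connectedComponentIn (W \ γ '' Set.Ioo 0 1) z}

/-- A fundamental chain in `(W, w)`: a nested sequence of crosscut neighborhoods with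
pairwise disjoint crosscut closures whose diameters tend to `0`. -/
def IsFundamentalChain (W : Set ℂ) (w : ℂ) (γ : ℕ → ℝ → ℂ) : Prop :=
  (∀ j, IsCrosscut W (γ j)) ∧ (∀ j, w ∉ γ j '' Set.Ioo 0 1) ∧
    (∀ j, crosscutNbhd W w (γ (j + 1)) ⊆ crosscutNbhd W w (γ j)) ∧
    (∀ i j, i ≠ j → Disjoint (γ i '' Set.Icc 0 1) (γ j '' Set.Icc 0 1)) ∧
    Filter.Tendsto (fun j => Metric.diam (γ j '' Set.Icc 0 1)) Filter.atTop (nhds 0)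

section

open Set Metric

/-- `f` has a continuous branch of the logarithm on `S`. -/
def HasContLogOn (f : ℂ → ℂ) (S : Set ℂ) : Prop :=
  ∃ L : ℂ → ℂ, ContinuousOn L S ∧ ∀ x ∈ S, Complex.exp (L x) = f x

namespace HasContLogOn

variable {f g : ℂ → ℂ} {S T : Set ℂ}

theorem mono (h : HasContLogOn f T) (hST : S ⊆ T) : HasContLogOn f S := by
  obtain ⟨L, hL, hLf⟩ := h
  exact ⟨L, hL.mono hST, fun x hx => hLf x (hST hx)⟩

theorem congr (h : HasContLogOn f S) (hfg : ∀ x ∈ S, f x = g x) : HasContLogOn g S := by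
  obtain ⟨L, hL, hLf⟩ := h
  exact ⟨L, hL, fun x hx => (hLf x hx).trans (hfg x hx)⟩

theorem mul (hf : HasContLogOn f S) (hg : HasContLogOn g S) :
    HasContLogOn (fun x => f x * g x) S := by
  obtain ⟨L, hL, hLf⟩ := hf
  obtain ⟨M, hM, hMg⟩ := hg
  exact ⟨fun x => L x + M x, hL.add hM, fun x hx => by rw [Complex.exp_add, hLf x hx, hMg x hx]⟩

theorem inv (hf : HasContLogOn f S) : HasContLogOn (fun x => (f x)⁻¹) S := by
  obtain ⟨L, hL, hLf⟩ := hf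
  exact ⟨fun x => -L x, hL.neg, fun x hx => by rw [Complex.exp_neg, hLf x hx]⟩

theorem div (hf : HasContLogOn f S) (hg : HasContLogOn g S) :
    HasContLogOn (fun x => f x / g x) S :=
  (hf.mul hg.inv).congr fun x _ => (div_eq_mul_inv (f x) (g x)).symm

theorem of_isSimplyConnected (hS : IsSimplyConnected S) (hSo : IsOpen S)
    (hf : ContinuousOn f S) (hf0 : ∀ x ∈ S, f x ≠ 0) : HasContLogOn f S := by
  obtain ⟨L, hL, hLf⟩ := Complex.exists_continuousOn_eqOn_exp_comp hS hSo hf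
    (by rintro ⟨x, hx, h0⟩; exact hf0 x hx h0)
  exact ⟨L, hL, hLf⟩

theorem of_convex (hS : Convex ℝ S) (hSo : IsOpen S) (hf : ContinuousOn f S)
    (hf0 : ∀ x ∈ S, f x ≠ 0) : HasContLogOn f S := by
  rcases S.eq_empty_or_nonempty with rfl | hne
  · exact ⟨f, continuousOn_empty f, by simp⟩
  · have := hS.contractibleSpace hne
    exact of_isSimplyConnected (inferInstanceAs (SimplyConnectedSpace S)) hSo hf hf0

end HasContLogOn

theorem isDiscrete_setOf_exp_eq_one : IsDiscrete {z : ℂ | Complex.exp z = 1} := by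
  have h : {z : ℂ | Complex.exp z = 1} =
      (AddSubgroup.zmultiples (2 * Real.pi * Complex.I : ℂ) : Set ℂ) := by
    ext z
    simp [Complex.exp_eq_one_iff, AddSubgroup.mem_zmultiples_iff, eq_comm]
  rw [h, isDiscrete_iff_discreteTopology]
  exact NormedSpace.discreteTopology_zmultiples _

/-- Two continuous logarithms of the same function on a preconnected set differ by a constant. -/
theorem exists_eq_add_of_exp_eq {X : Type*} [TopologicalSpace X] {S : Set X}
    (hS : IsPreconnected S) {L M : X → ℂ} (hL : ContinuousOn L S) (hM : ContinuousOn M S)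
    (h : ∀ x ∈ S, Complex.exp (L x) = Complex.exp (M x)) :
    ∃ c, Complex.exp c = 1 ∧ ∀ x ∈ S, L x = M x + c := by
  obtain ⟨c, hc, hcS⟩ := hS.eqOn_const_of_mapsTo isDiscrete_setOf_exp_eq_one (hL.sub hM)
    (fun x hx => by
      simp only [mem_ofPred_eq, Pi.sub_apply, Complex.exp_sub, h x hx]
      exact div_self (Complex.exp_ne_zero _)) ⟨0, by simp⟩
  refine ⟨c, hc, fun x hx => ?_⟩
  have := hcS hx
  simp only [Pi.sub_apply, Function.const_apply] at this
  rw [← this]; ring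

/-- Gluing of continuous logarithms along a preconnected intersection. -/
theorem HasContLogOn.union {f : ℂ → ℂ} {A B : Set ℂ} (hA : HasContLogOn f A)
    (hB : HasContLogOn f B) (hAB : IsPreconnected (A ∩ B))
    (hoc : (IsOpen A ∧ IsOpen B) ∨ (IsClosed A ∧ IsClosed B)) : HasContLogOn f (A ∪ B) := by
  classical
  obtain ⟨L, hL, hLf⟩ := hA
  obtain ⟨M, hM, hMf⟩ := hB
  obtain ⟨c, hc, hLM⟩ := exists_eq_add_of_exp_eq hAB (hL.mono inter_subset_left)
    (hM.mono inter_subset_right) fun x hx => (hLf x hx.1).trans (hMf x hx.2).symm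
  have hPA : EqOn (fun x => if x ∈ A then L x else M x + c) L A := fun x hx => if_pos hx
  have hPB : EqOn (fun x => if x ∈ A then L x else M x + c) (fun x => M x + c) B := fun x hx => by
    by_cases hxA : x ∈ A
    · simp [hxA, hLM x ⟨hxA, hx⟩]
    · simp [hxA]
  have hcA := hL.congr hPA
  have hcB := (hM.add continuousOn_const).congr hPB
  refine ⟨fun x => if x ∈ A then L x else M x + c, ?_, fun x hx => ?_⟩
  · rcases hoc with ⟨h₁, h₂⟩ | ⟨h₁, h₂⟩
    · exact hcA.union_of_isOpen hcB h₁ h₂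
    · exact hcA.union_of_isClosed hcB h₁ h₂
  · rcases hx with hx | hx
    · rw [hPA hx, hLf x hx]
    · rw [hPB hx, Complex.exp_add, hc, hMf x hx, mul_one]

/-- The identity has no continuous logarithm on a circle. -/
theorem not_hasContLogOn_sphere (a : ℂ) {r : ℝ} (hr : 0 < r) :
    ¬ HasContLogOn (fun x => x - a) (sphere a r) := by
  rintro ⟨L, hL, hLf⟩
  have hmem : ∀ θ : ℝ, circleMap a r θ ∈ sphere a r := fun θ =>
    circleMap_mem_sphere a hr.le θ
  have hcont : Continuous fun θ : ℝ => L (circleMap a r θ) :=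
    hL.comp_continuous (continuous_circleMap a r) hmem
  obtain ⟨c, -, hc⟩ := exists_eq_add_of_exp_eq (X := ℝ) isPreconnected_univ
    (L := fun θ => L (circleMap a r θ)) (M := fun θ => Complex.log r + θ * Complex.I)
    hcont.continuousOn (by fun_prop) (fun θ _ => by
      rw [hLf _ (hmem θ), Complex.exp_add, Complex.exp_log (by exact_mod_cast hr.ne')]
      simp [circleMap])
  have h0 := hc 0 (mem_univ _)
  have h1 := hc (2 * Real.pi) (mem_univ _)
  have hper : circleMap a r (2 * Real.pi) = circleMap a r 0 := by simp [circleMap]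
  rw [hper, h0] at h1
  have : (2 * Real.pi * Complex.I : ℂ) = 0 := by
    push_cast at h1; linear_combination -h1
  exact Complex.two_pi_I_ne_zero this

/-- A nonvanishing function homotopic to `1` through nonvanishing functions has a continuous
logarithm. -/
theorem exists_exp_eq_of_homotopy {A : Type*} [TopologicalSpace A] {H : unitInterval × A → ℂ}
    (hH : Continuous H) (hne : ∀ q, H q ≠ 0) (h0 : ∀ a, H (0, a) = 1) :
    ∃ F : A → ℂ, Continuous F ∧ ∀ a, Complex.exp (F a) = H (1, a) := by
  let H' : C(unitInterval × A, {z : ℂ // z ≠ 0}) := ⟨fun q => ⟨H q, hne q⟩, by fun_prop⟩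
  obtain ⟨F, hF⟩ : ∃ F : C(unitInterval × A, ℂ),
      (fun z : ℂ => (⟨_, z.exp_ne_zero⟩ : {z : ℂ // z ≠ 0})) ∘ F = H' :=
    ⟨_, Complex.isCoveringMap_exp.liftHomotopy_lifts H' (ContinuousMap.const A 0)
      fun a => Subtype.ext (by simp [H', h0])⟩
  exact ⟨fun a => F (1, a), by fun_prop, fun a => congrArg Subtype.val (congrFun hF (1, a))⟩

/-- The function `(x - p 0) / (x - p 1)` has a continuous logarithm off the path `p`. -/
theorem hasContLogOn_compl_range (p : C(unitInterval, ℂ)) :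
    HasContLogOn (fun x => (x - p 0) / (x - p 1)) (range p)ᶜ := by
  classical
  have hne : ∀ (t : unitInterval) (x : ↥(range p)ᶜ), (x : ℂ) - p t ≠ 0 := fun t x h =>
    x.2 ⟨t, (sub_eq_zero.1 h).symm⟩
  obtain ⟨F, hFc, hF⟩ := exists_exp_eq_of_homotopy (A := ↥(range p)ᶜ)
    (H := fun q => ((q.2 : ℂ) - p 0) / ((q.2 : ℂ) - p q.1))
    (Continuous.div (by fun_prop) (by fun_prop) fun q => hne q.1 q.2)
    (fun q => div_ne_zero (hne 0 q.2) (hne q.1 q.2)) (fun x => div_self (hne 0 x))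
  refine ⟨fun x => if hx : x ∈ (range p)ᶜ then F ⟨x, hx⟩ else 0, ?_, fun x hx => ?_⟩
  · rw [continuousOn_iff_continuous_domRestrict]
    convert hFc using 1
    ext x
    exact dif_pos x.2
  · simp only [dif_pos hx, hF]

/-- `(x - a) / (x - b)` has no continuous logarithm on the twice punctured plane. -/
theorem not_hasContLogOn_compl_pair {a b : ℂ} (hab : a ≠ b) :
    ¬ HasContLogOn (fun x => (x - a) / (x - b)) ({a, b}ᶜ) := by
  intro h
  have hd : 0 < dist a b := dist_pos.2 hab
  have hball : HasContLogOn (fun x => x - b) (ball a (dist a b)) :=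
    .of_convex (convex_ball _ _) isOpen_ball (by fun_prop) fun x hx h0 => by
      rw [sub_eq_zero.1 h0, mem_ball, dist_comm] at hx
      exact hx.false
  have hsub : sphere a (dist a b / 2) ⊆ ball a (dist a b) :=
    sphere_subset_closedBall.trans (closedBall_subset_ball (by linarith))
  have hxb : ∀ x ∈ sphere a (dist a b / 2), x ≠ b := by
    rintro x hx rfl
    have := hsub hx
    rw [mem_ball, dist_comm] at this
    exact this.false
  refine not_hasContLogOn_sphere a (half_pos hd) (((h.mono ?_).mul (hball.mono hsub)).congr ?_)
  · rintro x hx (rfl | rfl)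
    · rw [mem_sphere, dist_self] at hx; linarith
    · exact hxb _ hx rfl
  · intro x hx
    exact div_mul_cancel₀ _ (sub_ne_zero.2 (hxb x hx))

/-- If `z` lies in a bounded set `U`, and `w` lies outside `U`, then `(x - z) / (x - w)` has no
continuous logarithm on a closed set containing the boundary of `U`, unless it contains `w`. -/
theorem not_hasContLogOn_of_frontier_subset {U K : Set ℂ} {z w : ℂ}
    (hUb : Bornology.IsBounded U) (hK : IsClosed K) (hUK : frontier U ⊆ K) (hz : z ∈ U)
    (hw : w ∉ U) (hwK : w ∉ K) : ¬ HasContLogOn (fun x => (x - z) / (x - w)) K := by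
  classical
  rintro ⟨L, hL, hLf⟩
  obtain ⟨M, hM⟩ := ContinuousMap.exists_restrict_eq hK
    ⟨K.domRestrict L, continuousOn_iff_continuous_domRestrict.1 hL⟩
  have hML : ∀ x ∈ K, M x = L x := fun x hx => DFunLike.congr_fun hM ⟨x, hx⟩
  have hcont : Continuous fun x => if x ∈ U then (x - w) * Complex.exp (M x) else x - z := by
    refine Continuous.if (fun x hx => ?_) (by fun_prop) (by fun_prop)
    have hxK : x ∈ K := hUK hx
    rw [hML x hxK, hLf x hxK, mul_div_cancel₀]
    exact sub_ne_zero.2 fun h => hwK (h ▸ hxK)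
  have hlog := HasContLogOn.of_convex convex_univ isOpen_univ hcont.continuousOn fun x _ => by
    by_cases hx : x ∈ U
    · simp only [hx, if_true]
      exact mul_ne_zero (sub_ne_zero.2 fun h => hw (h ▸ hx)) (Complex.exp_ne_zero _)
    · simp only [hx, if_false]
      exact sub_ne_zero.2 fun h => hx (h ▸ hz)
  obtain ⟨r, hr, hUr⟩ := hUb.subset_ball_lt 0 z
  refine not_hasContLogOn_sphere z hr ((hlog.mono (subset_univ _)).congr fun x hx => if_neg ?_)
  intro hxU
  exact (mem_ball.1 (hUr hxU)).ne (mem_sphere.1 hx)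

theorem frontier_connectedComponentIn_subset_compl {X : Type*} [TopologicalSpace X]
    [LocallyConnectedSpace X] {E : Set X} (hE : IsOpen E) (z : X) :
    frontier (connectedComponentIn E z) ⊆ Eᶜ := by
  intro x hx hxE
  obtain ⟨y, hyx, hyz⟩ := mem_closure_iff.1 (frontier_subset_closure hx) _
    (hE.connectedComponentIn (x := x)) (mem_connectedComponentIn hxE)
  have hxz : x ∈ connectedComponentIn E z := by
    rw [connectedComponentIn_eq hyz, ← connectedComponentIn_eq hyx]
    exact mem_connectedComponentIn hxE
  rw [hE.connectedComponentIn.frontier_eq] at hx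
  exact hx.2 hxz

/-- Compact locally connected subsets are uniformly locally connected. -/
theorem IsCompact.exists_isPreconnected_subset_closedBall {X : Type*} [MetricSpace X] {K : Set X}
    (hK : IsCompact K) [LocallyConnectedSpace K] {ε : ℝ} (hε : 0 < ε) :
    ∃ δ > 0, ∀ a ∈ K, ∀ b ∈ K, dist a b < δ → ∃ C ⊆ K, IsClosed C ∧ IsPreconnected C ∧
      a ∈ C ∧ b ∈ C ∧ C ⊆ closedBall a ε := by
  have : CompactSpace K := isCompact_iff_compactSpace.1 hK
  have h : ∀ p : K, ∃ U : Set K, (IsOpen U ∧ p ∈ U ∧ IsConnected U) ∧ U ⊆ ball p (ε / 2) :=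
    fun p => (LocallyConnectedSpace.open_connected_basis p).mem_iff.1 (ball_mem_nhds p (half_pos hε))
  choose U hU hUε using h
  obtain ⟨δ, hδ, hδU⟩ := lebesgue_number_lemma_of_metric (isCompact_univ (X := K))
    (fun p => (hU p).1) fun p _ => mem_iUnion.2 ⟨p, (hU p).2.1⟩
  refine ⟨δ, hδ, fun a ha b hb hab => ?_⟩
  obtain ⟨p, hp⟩ := hδU ⟨a, ha⟩ (mem_univ _)
  have haU : (⟨a, ha⟩ : K) ∈ U p := hp (mem_ball_self hδ)
  have hbU : (⟨b, hb⟩ : K) ∈ U p := hp (by rw [mem_ball, dist_comm]; exact hab)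
  refine ⟨closure (Subtype.val '' U p), ?_, isClosed_closure, ?_, ?_, ?_, ?_⟩
  · exact closure_minimal (Subtype.coe_image_subset K _) hK.isClosed
  · exact ((hU p).2.2.isPreconnected.image _ continuous_subtype_val.continuousOn).closure
  · exact subset_closure ⟨_, haU, rfl⟩
  · exact subset_closure ⟨_, hbU, rfl⟩
  · refine closure_minimal ?_ isClosed_closedBall
    rintro _ ⟨x, hx, rfl⟩
    have h1 : dist (x : X) p < ε / 2 := hUε p hx
    have h2 : dist a p < ε / 2 := hUε p haU
    exact (dist_triangle_right (x : X) a p).trans (by linarith)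

theorem IsOpen.notMem_of_mem_frontier {X : Type*} [TopologicalSpace X] {W : Set X}
    (hW : IsOpen W) {x : X} (hx : x ∈ frontier W) : x ∉ W :=
  (hW.frontier_eq ▸ hx).2

theorem image_Icc_subset_image_Ioo_union_pair {α : Type*} (γ : ℝ → α) :
    γ '' Icc 0 1 ⊆ γ '' Ioo 0 1 ∪ {γ 0, γ 1} := by
  rintro _ ⟨t, ht, rfl⟩
  rcases ht.1.eq_or_lt with rfl | h0
  · simp
  · rcases ht.2.eq_or_lt with rfl | h1
    · simp
    · exact Or.inl ⟨t, ⟨h0, h1⟩, rfl⟩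

namespace IsCrosscut

variable {W : Set ℂ} {γ : ℝ → ℂ}

theorem image_Ioo_subset (hγ : IsCrosscut W γ) : γ '' Ioo 0 1 ⊆ W := by
  rintro _ ⟨t, ht, rfl⟩
  exact hγ.2.2.1 t ht

theorem isCompact_image (hγ : IsCrosscut W γ) : IsCompact (γ '' Icc 0 1) :=
  isCompact_Icc.image_of_continuousOn hγ.1

theorem diff_image_Ioo_eq (hγ : IsCrosscut W γ) (hW : IsOpen W) :
    W \ γ '' Ioo 0 1 = W \ γ '' Icc 0 1 := by
  refine Subset.antisymm (fun x hx => ⟨hx.1, fun h => ?_⟩)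
    (sdiff_subset_sdiff_right (image_mono Ioo_subset_Icc_self))
  rcases image_Icc_subset_image_Ioo_union_pair γ h with h | rfl | rfl
  · exact hx.2 h
  · exact hW.notMem_of_mem_frontier hγ.2.2.2.1 hx.1
  · exact hW.notMem_of_mem_frontier hγ.2.2.2.2 hx.1

theorem isOpen_diff (hγ : IsCrosscut W γ) (hW : IsOpen W) : IsOpen (W \ γ '' Ioo 0 1) := by
  rw [hγ.diff_image_Ioo_eq hW]
  exact hW.sdiff hγ.isCompact_image.isClosed

/-- A crosscut separates a simply connected domain. -/
theorem not_isPreconnected_diff (hγ : IsCrosscut W γ) (hW : IsOpen W)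
    (hWsc : IsSimplyConnected W) : ¬ IsPreconnected (W \ γ '' Ioo 0 1) := by
  intro hpre
  have hab : γ 0 ≠ γ 1 := fun h =>
    zero_ne_one (hγ.2.1 (left_mem_Icc.2 zero_le_one) (right_mem_Icc.2 zero_le_one) h)
  have ha := hW.notMem_of_mem_frontier hγ.2.2.2.1
  have hb := hW.notMem_of_mem_frontier hγ.2.2.2.2
  have hWb : ∀ x ∈ W, x - γ 1 ≠ 0 := fun x hx h => hb (sub_eq_zero.1 h ▸ hx)
  have hlogW : HasContLogOn (fun x => (x - γ 0) / (x - γ 1)) W :=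
    .of_isSimplyConnected hWsc hW (ContinuousOn.div (by fun_prop) (by fun_prop) hWb)
      fun x hx => div_ne_zero (sub_ne_zero.2 fun h => ha (h ▸ hx)) (hWb x hx)
  let p : C(unitInterval, ℂ) :=
    ⟨(Icc 0 1).domRestrict γ, continuousOn_iff_continuous_domRestrict.1 hγ.1⟩
  have hp : range p = γ '' Icc 0 1 := range_domRestrict γ _
  have hlogγ : HasContLogOn (fun x => (x - γ 0) / (x - γ 1)) (γ '' Icc 0 1)ᶜ :=
    hp ▸ hasContLogOn_compl_range p
  refine not_hasContLogOn_compl_pair hab ((hlogW.union hlogγ ?_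
    (Or.inl ⟨hW, hγ.isCompact_image.isClosed.isOpen_compl⟩)).mono ?_)
  · rwa [← sdiff_eq, ← hγ.diff_image_Ioo_eq hW]
  · intro x hx
    by_contra h
    rw [mem_union, not_or, notMem_compl_iff] at h
    rcases image_Icc_subset_image_Ioo_union_pair γ h.2 with h' | h'
    · exact h.1 (hγ.image_Ioo_subset h')
    · exact hx h'

theorem crosscutNbhd_nonempty (hγ : IsCrosscut W γ) (hW : IsOpen W)
    (hWsc : IsSimplyConnected W) (w : ℂ) : (crosscutNbhd W w γ).Nonempty := by
  by_contra hempty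
  refine hγ.not_isPreconnected_diff hW hWsc ?_
  refine isPreconnected_of_forall w fun z hz => ?_
  have hwz : w ∈ connectedComponentIn (W \ γ '' Ioo 0 1) z := by
    by_contra h
    exact hempty ⟨z, hz, h⟩
  exact ⟨_, connectedComponentIn_subset _ z, hwz, mem_connectedComponentIn hz,
    isPreconnected_connectedComponentIn⟩

/-- If the end points of a crosscut lie in a connected subset `C` of the boundary, and the crosscut
and `C` lie in a disc not containing the base point, then so does the crosscut neighborhood. -/
theorem crosscutNbhd_subset_ball (hγ : IsCrosscut W γ) (hW : IsOpen W) (hWc : IsConnected W)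
    (hWb : Bornology.IsBounded W) {w : ℂ} (hw : w ∈ W) {C : Set ℂ} (hCW : C ⊆ frontier W)
    (hCc : IsClosed C) (hC : IsPreconnected C) (h0 : γ 0 ∈ C) (h1 : γ 1 ∈ C) {c : ℂ} {r : ℝ}
    (hCr : C ⊆ ball c r) (hγr : γ '' Icc 0 1 ⊆ ball c r) (hwr : w ∉ ball c r) :
    crosscutNbhd W w γ ⊆ ball c r := by
  rintro z ⟨hz, hwz⟩
  by_contra hzr
  have hB : C ∪ γ '' Icc 0 1 ⊆ ball c r := union_subset hCr hγr
  have hBc : IsClosed (C ∪ γ '' Icc 0 1) := hCc.union hγ.isCompact_image.isClosed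
  have hne : ∀ u ∉ ball c r, ∀ x ∈ ball c r, x - u ≠ 0 := fun u hu x hx h =>
    hu (sub_eq_zero.1 h ▸ hx)
  have hlogB : HasContLogOn (fun x => (x - z) / (x - w)) (C ∪ γ '' Icc 0 1) :=
    (HasContLogOn.of_convex (convex_ball c r) isOpen_ball
      (ContinuousOn.div (by fun_prop) (by fun_prop) (hne w hwr))
      fun x hx => div_ne_zero (hne z hzr x hx) (hne w hwr x hx)).mono hB
  have hlogA : HasContLogOn (fun x => (x - z) / (x - w)) (frontier W) := by
    obtain ⟨p, hp⟩ := (hW.isConnected_iff_isPathConnected.1 hWc).joinedIn z hz.1 w hw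
    have h := hasContLogOn_compl_range p.toContinuousMap
    simp only [Path.coe_toContinuousMap, p.source, p.target] at h
    refine h.mono ?_
    rintro x hx ⟨t, rfl⟩
    exact hW.notMem_of_mem_frontier hx (hp t)
  have hAB : frontier W ∩ (C ∪ γ '' Icc 0 1) = C := by
    refine Subset.antisymm ?_ fun x hx => ⟨hCW hx, Or.inl hx⟩
    rintro x ⟨hxW, hx | hx⟩
    · exact hx
    · rcases image_Icc_subset_image_Ioo_union_pair γ hx with hx | rfl | rfl
      · exact (hW.notMem_of_mem_frontier hxW (hγ.image_Ioo_subset hx)).elim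
      · exact h0
      · exact h1
  have hUW : connectedComponentIn (W \ γ '' Ioo 0 1) z ⊆ W :=
    (connectedComponentIn_subset _ z).trans sdiff_subset
  refine not_hasContLogOn_of_frontier_subset (hWb.subset hUW)
    (isClosed_frontier.union hBc) ?_ (mem_connectedComponentIn hz) hwz ?_
    (hlogA.union hlogB (by rwa [hAB]) (Or.inr ⟨isClosed_frontier, hBc⟩))
  · intro x hx
    by_cases hxW : x ∈ W
    · have hxE := frontier_connectedComponentIn_subset_compl (hγ.isOpen_diff hW) z hx
      have hxγ : x ∈ γ '' Ioo 0 1 := by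
        by_contra h
        exact hxE ⟨hxW, h⟩
      exact Or.inr (Or.inr (image_mono Ioo_subset_Icc_self hxγ))
    · rw [hW.frontier_eq]
      exact Or.inl ⟨closure_mono hUW (frontier_subset_closure hx), hxW⟩
  · rintro (h | h)
    · exact hW.notMem_of_mem_frontier h hw
    · exact hwr (hB h)

/-- When the boundary is locally connected, small crosscuts have small neighborhoods. -/
theorem exists_crosscutNbhd_subset_ball (hWb : Bornology.IsBounded W) (hW : IsOpen W)
    (hWc : IsConnected W) [LocallyConnectedSpace (frontier W)] {w : ℂ} (hw : w ∈ W) {ε : ℝ}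
    (hε : 0 < ε) :
    ∃ δ > 0, ∀ γ, IsCrosscut W γ → diam (γ '' Icc 0 1) < δ →
      crosscutNbhd W w γ ⊆ ball (γ 0) ε := by
  obtain ⟨ρ, hρ, hρW⟩ := Metric.isOpen_iff.1 hW w hw
  have hr : 0 < min ε ρ := lt_min hε hρ
  have hK : IsCompact (frontier W) :=
    isCompact_of_isClosed_isBounded isClosed_frontier
      (hWb.closure.subset frontier_subset_closure)
  obtain ⟨δ, hδ, hδC⟩ := hK.exists_isPreconnected_subset_closedBall (half_pos hr)
  refine ⟨min δ (min ε ρ), lt_min hδ hr, fun γ hγ hdiam => ?_⟩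
  have hmem0 : γ 0 ∈ γ '' Icc 0 1 := ⟨0, left_mem_Icc.2 zero_le_one, rfl⟩
  have hmem1 : γ 1 ∈ γ '' Icc 0 1 := ⟨1, right_mem_Icc.2 zero_le_one, rfl⟩
  have hdist : ∀ x ∈ γ '' Icc 0 1, dist x (γ 0) < min δ (min ε ρ) := fun x hx =>
    (dist_le_diam_of_mem hγ.isCompact_image.isBounded hx hmem0).trans_lt hdiam
  obtain ⟨C, hCW, hCc, hC, h0, h1, hCr⟩ := hδC (γ 0) hγ.2.2.2.1 (γ 1) hγ.2.2.2.2 (by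
    rw [dist_comm]
    exact (hdist _ hmem1).trans_le (min_le_left _ _))
  refine (hγ.crosscutNbhd_subset_ball hW hWc hWb hw hCW hCc hC h0 h1
    (hCr.trans (closedBall_subset_ball (half_lt_self hr)))
    (fun x hx => (hdist x hx).trans_le (min_le_right _ _)) fun h => ?_).trans
    (ball_subset_ball (min_le_left _ _))
  refine hW.notMem_of_mem_frontier hγ.2.2.2.1 (hρW ?_)
  rw [mem_ball, dist_comm]
  exact (mem_ball.1 h).trans_le (min_le_right _ _)

end IsCrosscut

end

/-- If `∂W` is locally connected, then the impression of every prime end is trivial: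
every fundamental chain shrinks to a single point. -/
theorem impression_trivial_of_locallyConnected
    (W : Set ℂ) (hWb : Bornology.IsBounded W) (hWo : IsOpen W)
    (hWc : IsConnected W) (hWsc : SimplyConnectedSpace W)
    (w : ℂ) (hw : w ∈ W)
    (hlc : LocallyConnectedSpace (frontier W))
    (γ : ℕ → ℝ → ℂ) (hγ : IsFundamentalChain W w γ) :
    ∃ p : ℂ, (⋂ j, closure (crosscutNbhd W w (γ j))) = {p} := by
  obtain ⟨hcc, -, hnest, -, hdiam⟩ := hγ
  obtain ⟨p, hp⟩ := IsCompact.nonempty_iInter_of_sequence_nonempty_isCompact_isClosed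
    (fun j => closure (crosscutNbhd W w (γ j))) (fun j => closure_mono (hnest j))
    (fun j => ((hcc j).crosscutNbhd_nonempty hWo hWsc w).closure)
    (hWb.subset fun _ hz => hz.1.1).isCompact_closure (fun j => isClosed_closure)
  refine ⟨p, Set.eq_singleton_iff_unique_mem.2 ⟨hp, fun q hq => ?_⟩⟩
  refine eq_of_forall_dist_le fun ε hε => ?_
  obtain ⟨δ, hδ, hδN⟩ :=
    IsCrosscut.exists_crosscutNbhd_subset_ball hWb hWo hWc hw (half_pos hε)
  obtain ⟨j, hj⟩ := (hdiam.eventually_lt_const hδ).exists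
  have hball : closure (crosscutNbhd W w (γ j)) ⊆ Metric.closedBall (γ j 0) (ε / 2) :=
    (closure_mono (hδN _ (hcc j) hj)).trans Metric.closure_ball_subset_closedBall
  have hqj := Metric.mem_closedBall.1 (hball (Set.mem_iInter.1 hq j))
  have hpj := Metric.mem_closedBall.1 (hball (Set.mem_iInter.1 hp j))
  linarith [dist_triangle_right q p (γ j 0)]
end

section
/- Let W ⊆ ℂ be a bounded, open, connected, simply connected set and w ∈ W. If for every fundamental chain (γ_j) in (W,w) the intersection ⋂_j closure(N_{γ_j}) consists of a single point, then ∂W, with its subspace topology from ℂ, is locally connected. -/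
section RiemannMap

open Set Filter Topology Metric Complex MeasureTheory

/-- A locally uniform limit of nonvanishing holomorphic functions only vanishes at points near
which it is identically zero. -/
lemma eventually_eq_zero_of_tendstoLocallyUniformlyOn {ι : Type*} {l : Filter ι} [l.NeBot]
    {U : Set ℂ} (hU : IsOpen U) {F : ι → ℂ → ℂ} {f : ℂ → ℂ}
    (hF : TendstoLocallyUniformlyOn F f l U) (hd : ∀ n, DifferentiableOn ℂ (F n) U)
    (hne : ∀ n, ∀ z ∈ U, F n z ≠ 0) {a : ℂ} (ha : a ∈ U) (hfa : f a = 0) :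
    ∀ᶠ z in 𝓝 a, f z = 0 := by
  have hfd : DifferentiableOn ℂ f U := hF.differentiableOn (.of_forall hd) hU
  refine ((hfd.analyticAt (hU.mem_nhds ha)).eventually_eq_zero_or_eventually_ne_zero).resolve_right
    fun hev ↦ ?_
  rw [eventually_nhdsWithin_iff] at hev
  obtain ⟨r, hr, hball⟩ := nhds_basis_closedBall.mem_iff.1 (hev.and (hU.mem_nhds ha))
  have hsphere : sphere a r ⊆ U := fun z hz ↦ (hball (sphere_subset_closedBall hz)).2
  obtain ⟨c, hc, hmin⟩ := (isCompact_sphere a r).exists_isMinOn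
    (NormedSpace.sphere_nonempty.2 hr.le) (hfd.continuousOn.mono hsphere).norm
  have hm : 0 < ‖f c‖ :=
    norm_pos_iff.2 ((hball (sphere_subset_closedBall hc)).1 (ne_of_mem_sphere hc hr.ne'))
  have hunif := (tendstoLocallyUniformlyOn_iff_forall_isCompact hU).1 hF _ hsphere
    (isCompact_sphere a r)
  have h1 := Metric.tendstoUniformlyOn_iff.1 hunif (‖f c‖ / 2) (by positivity)
  have h2 := Metric.tendsto_nhds.1 (hF.tendsto_at ha) (‖f c‖ / 2) (by positivity)
  obtain ⟨n, hn1, hn2⟩ := (h1.and h2).exists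
  rw [hfa, dist_zero_right] at hn2
  have hsub : closedBall a r ⊆ U := fun z hz ↦ (hball hz).2
  have hdc : DiffContOnCl ℂ (fun z ↦ (F n z)⁻¹) (ball a r) := by
    refine DifferentiableOn.diffContOnCl_ball (U := U) ?_ hsub
    exact (hd n).inv (hne n)
  have key := norm_le_of_forall_mem_frontier_norm_le (C := (‖f c‖ / 2)⁻¹) isBounded_ball hdc
    (fun z hz ↦ ?_) (subset_closure (mem_ball_self hr))
  · rw [norm_inv] at key
    have := (inv_le_inv₀ (norm_pos_iff.2 (hne n a ha)) (by positivity)).1 key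
    linarith
  · rw [frontier_ball _ hr.ne'] at hz
    rw [norm_inv]
    have h3 := hn1 z hz
    have h4 : ‖f c‖ ≤ ‖f z‖ := hmin hz
    rw [dist_eq_norm] at h3
    have h5 := norm_sub_norm_le (f z) (F n z)
    exact inv_anti₀ (by positivity) (by linarith)

/-- Pointwise limits of uniformly bounded holomorphic functions are locally uniform. -/
lemma tendstoLocallyUniformlyOn_of_tendsto_of_norm_le_one {ι : Type*} {l : Filter ι} [l.NeBot]
    {U : Set ℂ} (hU : IsOpen U) {F : ι → ℂ → ℂ} {f : ℂ → ℂ}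
    (hF : ∀ z ∈ U, Tendsto (fun n ↦ F n z) l (𝓝 (f z)))
    (hd : ∀ n, DifferentiableOn ℂ (F n) U) (hle : ∀ n, ∀ z ∈ U, ‖F n z‖ ≤ 1) :
    TendstoLocallyUniformlyOn F f l U := by
  rw [Metric.tendstoLocallyUniformlyOn_iff]
  intro ε hε c hc
  obtain ⟨R, hR, hball⟩ := Metric.isOpen_iff.1 hU c hc
  have hlip : ∀ n, ∀ z ∈ ball c R, dist (F n z) (F n c) ≤ 2 / R * dist z c := by
    intro n z hz
    refine dist_le_div_mul_dist_of_mapsTo_ball ((hd n).mono hball) (fun u hu ↦ ?_) hz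
    rw [mem_closedBall, dist_eq_norm]
    linarith [norm_sub_le (F n u) (F n c), hle n u (hball hu), hle n c hc]
  have hlip' : ∀ z ∈ ball c R, dist (f z) (f c) ≤ 2 / R * dist z c := fun z hz ↦
    le_of_tendsto ((hF z (hball hz)).dist (hF c hc)) (.of_forall fun n ↦ hlip n z hz)
  have hr : 0 < min R (ε * R / 8) := by positivity
  refine ⟨ball c (min R (ε * R / 8)), mem_nhdsWithin_of_mem_nhds (ball_mem_nhds c hr), ?_⟩
  filter_upwards [Metric.tendsto_nhds.1 (hF c hc) (ε / 4) (by positivity)] with n hn z hz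
  have hz1 : z ∈ ball c R := ball_subset_ball (min_le_left _ _) hz
  have hz2 : dist z c < ε * R / 8 := lt_of_lt_of_le hz (min_le_right _ _)
  have h3 : 2 / R * dist z c ≤ ε / 4 := by
    calc 2 / R * dist z c ≤ 2 / R * (ε * R / 8) := by gcongr
      _ = ε / 4 := by field_simp; norm_num
  have := hlip n z hz1
  have := hlip' z hz1
  have t1 := dist_triangle (f z) (f c) (F n z)
  have t2 : dist (f c) (F n z) ≤ dist (F n c) (f c) + dist (F n z) (F n c) := by
    rw [dist_comm (F n c), dist_comm (F n z)]
    exact dist_triangle _ _ _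
  linarith

/-- The competitors in the extremal problem which produces the Riemann map. -/
structure IsDiscEmbedding (W : Set ℂ) (w : ℂ) (φ : ℂ → ℂ) : Prop where
  differentiableOn : DifferentiableOn ℂ φ W
  mapsTo : MapsTo φ W (ball 0 1)
  injOn : InjOn φ W
  deriv_ne_zero : ∀ z ∈ W, deriv φ z ≠ 0
  map_base : φ w = 0

lemma exists_isDiscEmbedding {W : Set ℂ} (hWb : Bornology.IsBounded W) (w : ℂ) :
    ∃ φ, IsDiscEmbedding W w φ := by
  obtain ⟨R, hR, hsub⟩ := hWb.subset_ball_lt 0 w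
  have hR' : (R : ℂ) ≠ 0 := by exact_mod_cast hR.ne'
  have hder : ∀ z, HasDerivAt (fun z : ℂ ↦ (z - w) / R) (1 / R) z := fun z ↦
    ((hasDerivAt_id z).sub_const w).div_const _
  refine ⟨fun z ↦ (z - w) / R, fun z _ ↦ (hder z).differentiableAt.differentiableWithinAt, ?_, ?_,
    fun z _ ↦ ?_, by simp⟩
  · intro z hz
    have := hsub hz
    rw [mem_ball, dist_eq_norm] at this
    rw [mem_ball_zero_iff, norm_div, norm_real, Real.norm_of_nonneg hR.le]
    exact (div_lt_one hR).2 this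
  · intro x _ y _ hxy
    simpa [div_left_inj' hR'] using hxy
  · rw [(hder z).deriv]
    simpa using hR'

lemma norm_deriv_le_of_isDiscEmbedding {W : Set ℂ} {w : ℂ} {R : ℝ} (hR : 0 < R)
    (hball : ball w R ⊆ W) {φ : ℂ → ℂ} (hφ : IsDiscEmbedding W w φ) : ‖deriv φ w‖ ≤ 1 / R :=
  norm_deriv_le_div_of_mapsTo_ball (hφ.differentiableOn.mono hball)
    (fun z hz ↦ by
      rw [hφ.map_base]
      exact ball_subset_closedBall (hφ.mapsTo (hball hz))) hR

/-- The extremal problem for the Riemann map has a solution. -/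
lemma exists_isDiscEmbedding_max {W : Set ℂ} (hWb : Bornology.IsBounded W) (hWo : IsOpen W)
    (hWc : IsConnected W) {w : ℂ} (hw : w ∈ W) :
    ∃ φ, IsDiscEmbedding W w φ ∧
      ∀ ψ, IsDiscEmbedding W w ψ → ‖deriv ψ w‖ ≤ ‖deriv φ w‖ := by
  obtain ⟨R, hR, hball⟩ := Metric.isOpen_iff.1 hWo w hw
  obtain ⟨φ₀, hφ₀⟩ := exists_isDiscEmbedding hWb w
  set S : Set ℝ := {x | ∃ φ, IsDiscEmbedding W w φ ∧ ‖deriv φ w‖ = x} with hS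
  have hSne : S.Nonempty := ⟨_, φ₀, hφ₀, rfl⟩
  have hSb : BddAbove S := ⟨1 / R, by
    rintro _ ⟨φ, hφ, rfl⟩
    exact norm_deriv_le_of_isDiscEmbedding hR hball hφ⟩
  obtain ⟨u, -, hu, huS⟩ := exists_seq_tendsto_sSup hSne hSb
  choose F hF hFu using huS
  set l : Ultrafilter ℕ := Ultrafilter.of atTop
  have hl : (l : Filter ℕ) ≤ atTop := Ultrafilter.of_le _
  have hnorm : ∀ n, ∀ z ∈ W, ‖F n z‖ ≤ 1 := fun n z hz ↦
    (mem_ball_zero_iff.1 ((hF n).mapsTo hz)).le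
  have hlim : ∀ z, ∃ v, z ∈ W → Tendsto (fun n ↦ F n z) l (𝓝 v) := by
    intro z
    by_cases hz : z ∈ W
    · obtain ⟨v, -, hv⟩ := (isCompact_closedBall (0 : ℂ) 1).ultrafilter_le_nhds
        (l.map fun n ↦ F n z) (by
          rw [le_principal_iff]
          exact Filter.mem_map.2 (univ_mem' fun n ↦ mem_closedBall_zero_iff.2 (hnorm n z hz)))
      exact ⟨v, fun _ ↦ hv⟩
    · exact ⟨0, fun h ↦ absurd h hz⟩
  choose φ hφ using hlim
  have hconv : TendstoLocallyUniformlyOn F φ l W :=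
    tendstoLocallyUniformlyOn_of_tendsto_of_norm_le_one hWo hφ
      (fun n ↦ (hF n).differentiableOn) hnorm
  have hd : DifferentiableOn ℂ φ W :=
    hconv.differentiableOn (.of_forall fun n ↦ (hF n).differentiableOn) hWo
  have hconv' : TendstoLocallyUniformlyOn (deriv ∘ F) (deriv φ) l W :=
    hconv.deriv (.of_forall fun n ↦ (hF n).differentiableOn) hWo
  have hderiv : ‖deriv φ w‖ = sSup S := by
    refine tendsto_nhds_unique (hconv'.tendsto_at hw).norm ?_
    simpa [hFu] using hu.mono_left hl
  have hmax : ∀ ψ, IsDiscEmbedding W w ψ → ‖deriv ψ w‖ ≤ ‖deriv φ w‖ := fun ψ hψ ↦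
    hderiv ▸ le_csSup hSb ⟨ψ, hψ, rfl⟩
  have hpos : 0 < ‖deriv φ w‖ :=
    (norm_pos_iff.2 (hφ₀.deriv_ne_zero w hw)).trans_le (hmax φ₀ hφ₀)
  have hana : AnalyticOnNhd ℂ φ W := hd.analyticOnNhd hWo
  have hnonconst : ∀ a ∈ W, ∀ c, ¬ ∀ᶠ z in 𝓝 a, φ z = c := by
    intro a ha c hev
    have h1 : EqOn φ (fun _ ↦ c) W :=
      hana.eqOn_of_preconnected_of_eventuallyEq analyticOnNhd_const hWc.isPreconnected ha hev
    have h2 : φ =ᶠ[𝓝 w] fun _ ↦ c := h1.eventuallyEq_of_mem (hWo.mem_nhds hw)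
    rw [h2.deriv_eq] at hpos
    simp at hpos
  have hbase : φ w = 0 := by
    refine tendsto_nhds_unique (hφ w hw) ?_
    simp [(hF _).map_base]
  have hle : ∀ z ∈ W, ‖φ z‖ ≤ 1 := fun z hz ↦
    le_of_tendsto (hφ z hz).norm (.of_forall fun n ↦ hnorm n z hz)
  refine ⟨φ, ⟨hd, fun z hz ↦ ?_, fun a ha b hb hab ↦ ?_, fun z hz h0 ↦ ?_, hbase⟩, hmax⟩
  · rw [mem_ball_zero_iff]
    refine (hle z hz).lt_of_ne fun h1 ↦ ?_
    have := norm_eqOn_of_isPreconnected_of_isMaxOn hWc.isPreconnected hWo hd hz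
      (fun y hy ↦ by simpa [h1] using hle y hy) hw
    simp [hbase, h1] at this
  · by_contra hne
    have hU : IsOpen (W \ {b}) := hWo.sdiff isClosed_singleton
    have hc : TendstoLocallyUniformlyOn (fun n z ↦ F n z - F n b) (fun z ↦ φ z - φ b) l
        (W \ {b}) := by
      rw [Metric.tendstoLocallyUniformlyOn_iff] at hconv ⊢
      intro ε hε x hx
      obtain ⟨t, ht, hev⟩ := hconv (ε / 2) (by positivity) x hx.1
      refine ⟨t, nhdsWithin_mono _ sdiff_subset ht, ?_⟩
      filter_upwards [hev, Metric.tendsto_nhds.1 (hφ b hb) (ε / 2) (by positivity)] with n h1 h2 y hy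
      calc dist (φ y - φ b) (F n y - F n b) ≤ dist (φ y) (F n y) + dist (φ b) (F n b) :=
            dist_sub_sub_le _ _ _ _
        _ < ε := by rw [dist_comm (φ b)]; linarith [h1 y hy]
    have := eventually_eq_zero_of_tendstoLocallyUniformlyOn hU hc
      (fun n ↦ (((hF n).differentiableOn.mono sdiff_subset).sub_const _))
      (fun n z hz h ↦ hz.2 ((hF n).injOn hz.1 hb (sub_eq_zero.1 h))) ⟨ha, hne⟩
      (sub_eq_zero.2 hab)
    exact hnonconst a ha (φ b) (this.mono fun z hz ↦ sub_eq_zero.1 hz)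
  · have hev := eventually_eq_zero_of_tendstoLocallyUniformlyOn hWo hconv'
      (fun n ↦ (hF n).differentiableOn.deriv hWo) (fun n ↦ (hF n).deriv_ne_zero) hz h0
    have h1 : EqOn (deriv φ) 0 W := hana.deriv.eqOn_zero_of_preconnected_of_eventuallyEq_zero
      hWc.isPreconnected hz hev
    have := h1 hw
    simp [this] at hpos

open scoped ComplexConjugate

lemma HasDerivAt.of_sq_eq {S h : ℂ → ℂ} {h' z : ℂ} (hS : ContinuousAt S z) (hh : HasDerivAt h h' z)
    (hsq : ∀ y, S y ^ 2 = h y) (hz : S z ≠ 0) : HasDerivAt S (h' / (2 * S z)) z := by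
  rw [hasDerivAt_iff_tendsto_slope] at hh ⊢
  have h1 : Tendsto (fun y ↦ S y + S z) (𝓝[≠] z) (𝓝 (2 * S z)) := by
    rw [two_mul]
    exact (hS.tendsto.mono_left nhdsWithin_le_nhds).add_const _
  have h2 : (2 : ℂ) * S z ≠ 0 := mul_ne_zero two_ne_zero hz
  refine (hh.div h1 h2).congr' ?_
  filter_upwards [h1.eventually_ne h2] with y hy
  simp only [Pi.div_apply, slope_def_field, ← hsq]
  field_simp
  ring

/-- The disc automorphism sending `c` to `0`. -/
noncomputable def discShift (c z : ℂ) : ℂ := (z - c) / (1 - conj c * z)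

lemma one_sub_conj_mul_ne_zero {c z : ℂ} (hc : ‖c‖ < 1) (hz : ‖z‖ < 1) : 1 - conj c * z ≠ 0 := by
  intro h
  have h1 : ‖conj c * z‖ = 1 := by rw [← sub_eq_zero.1 h, norm_one]
  rw [norm_mul, norm_conj] at h1
  nlinarith [norm_nonneg c, norm_nonneg z]

lemma hasDerivAt_discShift {c z : ℂ} (hc : ‖c‖ < 1) (hz : ‖z‖ < 1) :
    HasDerivAt (discShift c) ((1 - ‖c‖ ^ 2) / (1 - conj c * z) ^ 2) z := by
  have h := ((hasDerivAt_id z).sub_const c).div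
    (((hasDerivAt_id z).const_mul (conj c)).const_sub 1) (one_sub_conj_mul_ne_zero hc hz)
  refine h.congr_deriv ?_
  have := conj_mul' c
  simp only [id]
  congr 1
  linear_combination -this

lemma norm_discShift_lt_one {c z : ℂ} (hc : ‖c‖ < 1) (hz : ‖z‖ < 1) : ‖discShift c z‖ < 1 := by
  rw [discShift, norm_div, div_lt_one (norm_pos_iff.2 (one_sub_conj_mul_ne_zero hc hz))]
  refine lt_of_pow_lt_pow_left₀ 2 (norm_nonneg _) ?_
  have key : ‖1 - conj c * z‖ ^ 2 - ‖z - c‖ ^ 2 = (1 - ‖c‖ ^ 2) * (1 - ‖z‖ ^ 2) := by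
    simp only [← normSq_eq_norm_sq, normSq_apply]
    simp
    ring
  have : 0 < (1 - ‖c‖ ^ 2) * (1 - ‖z‖ ^ 2) := by
    apply mul_pos <;> nlinarith [norm_nonneg c, norm_nonneg z]
  linarith

lemma one_sub_norm_sq_ne_zero {c : ℂ} (hc : ‖c‖ < 1) : (1 - (‖c‖ : ℂ) ^ 2) ≠ 0 := by
  have : (1 - ‖c‖ ^ 2 : ℝ) ≠ 0 := by nlinarith [norm_nonneg c]
  exact_mod_cast this

lemma discShift_injOn {c : ℂ} (hc : ‖c‖ < 1) : InjOn (discShift c) (ball 0 1) := by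
  intro x hx y hy h
  rw [mem_ball_zero_iff] at hx hy
  rw [discShift, discShift, div_eq_div_iff (one_sub_conj_mul_ne_zero hc hx)
    (one_sub_conj_mul_ne_zero hc hy)] at h
  have h2 : (1 - (‖c‖ : ℂ) ^ 2) * (x - y) = 0 := by
    rw [← conj_mul' c]
    linear_combination h
  exact sub_eq_zero.1 ((mul_eq_zero.1 h2).resolve_left (one_sub_norm_sq_ne_zero hc))

lemma discShift_ne_zero {c z : ℂ} (hc : ‖c‖ < 1) (hz : ‖z‖ < 1) (h : z ≠ c) :
    discShift c z ≠ 0 :=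
  div_ne_zero (sub_ne_zero.2 h) (one_sub_conj_mul_ne_zero hc hz)

lemma exists_isDiscEmbedding_of_mapsTo {W : Set ℂ} {w : ℂ} (hWo : IsOpen W) (hw : w ∈ W) {S : ℂ → ℂ}
    (hd : DifferentiableOn ℂ S W) (hS : MapsTo S W (ball 0 1)) (hinj : InjOn S W)
    (hne : ∀ z ∈ W, deriv S z ≠ 0) :
    ∃ ψ, IsDiscEmbedding W w ψ ∧ ‖deriv ψ w‖ = ‖deriv S w‖ / (1 - ‖S w‖ ^ 2) := by
  have hS' : ∀ z ∈ W, ‖S z‖ < 1 := fun z hz ↦ mem_ball_zero_iff.1 (hS hz)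
  have hc := hS' w hw
  have hder : ∀ z ∈ W, HasDerivAt (discShift (S w) ∘ S)
      ((1 - ‖S w‖ ^ 2) / (1 - conj (S w) * S z) ^ 2 * deriv S z) z := fun z hz ↦
    (hasDerivAt_discShift hc (hS' z hz)).comp z
      (hd.differentiableAt (hWo.mem_nhds hz)).hasDerivAt
  refine ⟨discShift (S w) ∘ S, ⟨fun z hz ↦ (hder z hz).differentiableAt.differentiableWithinAt,
    fun z hz ↦ mem_ball_zero_iff.2 (norm_discShift_lt_one hc (hS' z hz)),
    (discShift_injOn hc).comp hinj hS, fun z hz ↦ ?_, by simp [discShift]⟩, ?_⟩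
  · rw [(hder z hz).deriv]
    exact mul_ne_zero (div_ne_zero (one_sub_norm_sq_ne_zero hc)
      (pow_ne_zero 2 (one_sub_conj_mul_ne_zero hc (hS' z hz)))) (hne z hz)
  · rw [(hder w hw).deriv, conj_mul']
    have h1 : (1 - (‖S w‖ : ℂ) ^ 2) / (1 - (‖S w‖ : ℂ) ^ 2) ^ 2 = ((1 - ‖S w‖ ^ 2)⁻¹ : ℝ) := by
      have := one_sub_norm_sq_ne_zero hc
      push_cast
      field_simp
    have h2 : 0 ≤ (1 - ‖S w‖ ^ 2)⁻¹ := by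
      rw [inv_nonneg]
      nlinarith [norm_nonneg (S w)]
    rw [h1, norm_mul, norm_real, Real.norm_of_nonneg h2, div_eq_inv_mul]

/-- The square root trick of Koebe. -/
lemma surjOn_of_isDiscEmbedding_max {W : Set ℂ} (hWo : IsOpen W) (hWc : IsSimplyConnected W)
    {w : ℂ} (hw : w ∈ W) {φ : ℂ → ℂ} (hφ : IsDiscEmbedding W w φ)
    (hmax : ∀ ψ, IsDiscEmbedding W w ψ → ‖deriv ψ w‖ ≤ ‖deriv φ w‖) :
    SurjOn φ W (ball 0 1) := by
  intro c hc
  by_contra hcW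
  rw [mem_ball_zero_iff] at hc
  have hφ' : ∀ z ∈ W, ‖φ z‖ < 1 := fun z hz ↦ mem_ball_zero_iff.1 (hφ.mapsTo hz)
  set h := discShift c ∘ φ with hh
  have hder : ∀ z ∈ W, HasDerivAt h
      ((1 - ‖c‖ ^ 2) / (1 - conj c * φ z) ^ 2 * deriv φ z) z := fun z hz ↦
    (hasDerivAt_discShift hc (hφ' z hz)).comp z
      (hφ.differentiableOn.differentiableAt (hWo.mem_nhds hz)).hasDerivAt
  have hne : ∀ z ∈ W, h z ≠ 0 := fun z hz ↦
    discShift_ne_zero hc (hφ' z hz) fun h ↦ hcW ⟨z, hz, h⟩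
  obtain ⟨S, hSc, hS⟩ := exists_continuousOn_pow_eq hWc hWo
    (g := h) (fun z hz ↦ (hder z hz).continuousAt.continuousWithinAt)
    (by rintro ⟨z, hz, h0⟩; exact hne z hz h0) two_ne_zero
  have hSne : ∀ z ∈ W, S z ≠ 0 := fun z hz h0 ↦ hne z hz (by rw [← hS, h0]; simp)
  have hSder : ∀ z ∈ W, HasDerivAt S
      ((1 - ‖c‖ ^ 2) / (1 - conj c * φ z) ^ 2 * deriv φ z / (2 * S z)) z := fun z hz ↦
    .of_sq_eq (hSc.continuousAt (hWo.mem_nhds hz)) (hder z hz) hS (hSne z hz)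
  obtain ⟨ψ, hψ, hψw⟩ := exists_isDiscEmbedding_of_mapsTo (S := S) hWo hw
    (fun z hz ↦ (hSder z hz).differentiableAt.differentiableWithinAt)
    (fun z hz ↦ by
      rw [mem_ball_zero_iff, ← sq_lt_one_iff₀ (norm_nonneg _), ← norm_pow, hS]
      exact norm_discShift_lt_one hc (hφ' z hz))
    (fun x hx y hy hxy ↦ hφ.injOn hx hy (discShift_injOn hc (hφ.mapsTo hx) (hφ.mapsTo hy)
      (by
        have : h x = h y := by rw [← hS, ← hS, hxy]
        exact this)))
    (fun z hz ↦ by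
      rw [(hSder z hz).deriv]
      exact div_ne_zero (mul_ne_zero (div_ne_zero (one_sub_norm_sq_ne_zero hc)
        (pow_ne_zero 2 (one_sub_conj_mul_ne_zero hc (hφ' z hz)))) (hφ.deriv_ne_zero z hz))
        (mul_ne_zero two_ne_zero (hSne z hz)))
  have hle := hmax ψ hψ
  have hpos : 0 < ‖deriv φ w‖ := norm_pos_iff.2 (hφ.deriv_ne_zero w hw)
  set s := ‖S w‖ with hs
  have hs0 : 0 < s := norm_pos_iff.2 (hSne w hw)
  have hsc : s ^ 2 = ‖c‖ := by
    rw [hs, ← norm_pow, hS, hh]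
    simp [discShift, hφ.map_base]
  have hs1 : s < 1 := by
    rw [← sq_lt_one_iff₀ hs0.le, hsc]
    exact hc
  have h1 : ‖(1 - (‖c‖ : ℂ) ^ 2)‖ = 1 - ‖c‖ ^ 2 := by
    rw [show (1 - (‖c‖ : ℂ) ^ 2) = ((1 - ‖c‖ ^ 2 : ℝ) : ℂ) by push_cast; rfl, norm_real,
      Real.norm_of_nonneg]
    nlinarith [norm_nonneg c]
  rw [hψw, (hSder w hw).deriv, hφ.map_base, mul_zero, sub_zero, one_pow, div_one, norm_div,
    norm_mul, h1, norm_mul, Complex.norm_ofNat, ← hs, ← hsc, div_div,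
    div_le_iff₀ (by have : 0 < 1 - s ^ 2 := by nlinarith
                    positivity)] at hle
  have h2 : (1 - (s ^ 2) ^ 2) ≤ 2 * s * (1 - s ^ 2) := by
    refine le_of_mul_le_mul_right ?_ hpos
    linarith
  have h3 : 0 < (1 - s) ^ 2 * (1 - s ^ 2) := by
    have : 0 < 1 - s := by linarith
    have : 0 < 1 - s ^ 2 := by nlinarith
    positivity
  nlinarith

/-- The Riemann mapping theorem for bounded domains. -/
theorem exists_riemannMap {W : Set ℂ} (hWb : Bornology.IsBounded W) (hWo : IsOpen W)
    (hWc : IsSimplyConnected W) {w : ℂ} (hw : w ∈ W) :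
    ∃ f φ : ℂ → ℂ, DifferentiableOn ℂ f (ball 0 1) ∧ ContinuousOn φ W ∧
      MapsTo f (ball 0 1) W ∧ MapsTo φ W (ball 0 1) ∧ LeftInvOn φ f (ball 0 1) ∧
      LeftInvOn f φ W ∧ f 0 = w := by
  have hconn : IsConnected W := hWc.isPathConnected.isConnected
  obtain ⟨φ, hφ, hmax⟩ := exists_isDiscEmbedding_max hWb hWo hconn hw
  have hsurj := surjOn_of_isDiscEmbedding_max hWo hWc hw hφ hmax
  set f := Function.invFunOn φ W with hf
  have hfW : MapsTo f (ball 0 1) W := fun z hz ↦ Function.invFunOn_mem (hsurj hz)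
  have hφf : LeftInvOn φ f (ball 0 1) := fun z hz ↦ Function.invFunOn_eq (hsurj hz)
  have hfφ : LeftInvOn f φ W := hφ.injOn.leftInvOn_invFunOn
  have hopen : ∀ s ⊆ W, IsOpen s → IsOpen (φ '' s) := by
    refine ((hφ.differentiableOn.analyticOnNhd hWo).is_constant_or_isOpen
      hconn.isPreconnected).resolve_left ?_
    rintro ⟨v, hv⟩
    have h2 : φ =ᶠ[𝓝 w] fun _ ↦ v := eventually_of_mem (hWo.mem_nhds hw) hv
    exact hφ.deriv_ne_zero w hw (by rw [h2.deriv_eq]; simp)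
  have hcont : ∀ z ∈ ball (0 : ℂ) 1, ContinuousAt f z := by
    intro z hz
    rw [continuousAt_def]
    intro A hA
    obtain ⟨V, hVA, hVo, hzV⟩ := _root_.mem_nhds_iff.1 hA
    refine mem_of_superset ((hopen (V ∩ W) inter_subset_right (hVo.inter hWo)).mem_nhds
      ⟨f z, ⟨hzV, hfW hz⟩, hφf hz⟩) ?_
    rintro _ ⟨x, hx, rfl⟩
    rw [mem_preimage, hfφ hx.2]
    exact hVA hx.1
  refine ⟨f, φ, fun z hz ↦ ?_, hφ.differentiableOn.continuousOn, hfW, hφ.mapsTo, hφf, hfφ, ?_⟩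
  · have h1 : HasStrictDerivAt φ (deriv φ (f z)) (f z) :=
      (hφ.differentiableOn.analyticAt (hWo.mem_nhds (hfW hz))).hasStrictDerivAt
    exact (HasStrictDerivAt.of_local_left_inverse (hcont z hz) h1 (hφ.deriv_ne_zero _ (hfW hz))
      (eventually_of_mem (isOpen_ball.mem_nhds hz) hφf)).hasDerivAt.differentiableAt.differentiableWithinAt
  · rw [← hφ.map_base, hfφ hw]

end RiemannMap

section LengthArea

open Set Filter Topology Metric Complex MeasureTheory
open scoped ENNReal

/-- The area of the image of an injective holomorphic map is the integral of the squared norm of its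
derivative. -/
lemma setLIntegral_enorm_deriv_sq {g : ℂ → ℂ} {s : Set ℂ} (hs : IsOpen s)
    (hg : DifferentiableOn ℂ g s) (hinj : InjOn g s) :
    ∫⁻ z in s, ‖deriv g z‖ₑ ^ 2 = volume (g '' s) := by
  have h := lintegral_image_eq_lintegral_abs_det_fderiv_mul volume hs.measurableSet
    (f' := fun z ↦ ((ContinuousLinearMap.toSpanSingleton ℂ (deriv g z)).restrictScalars ℝ))
    (fun z hz ↦ (((hg.differentiableAt (hs.mem_nhds hz)).hasDerivAt.hasFDerivAt).restrictScalars
      ℝ).hasFDerivWithinAt) hinj (fun _ ↦ 1)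
  rw [lintegral_one, Measure.restrict_apply_univ] at h
  rw [h]
  refine lintegral_congr fun z ↦ ?_
  have : ((ContinuousLinearMap.toSpanSingleton ℂ (deriv g z)).restrictScalars ℝ).det
      = ‖deriv g z‖ ^ 2 := by
    simp [ContinuousLinearMap.det, LinearMap.det_restrictScalars,
      Algebra.norm_complex_eq, Complex.normSq_eq_norm_sq]
  rw [this, mul_one, abs_of_nonneg (by positivity), ENNReal.ofReal_pow (norm_nonneg _),
    ofReal_norm]

/-- A function with small integral over a box has small integral along many parallel lines. -/
lemma exists_notMem_lintegral_le {F : ℝ → ℝ≥0∞} (hF : Measurable F) {c d : ℝ} (hcd : c < d)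
    {η : ℝ≥0∞} (h : ∫⁻ y in Ioo c d, F y ≤ η * ENNReal.ofReal (d - c)) {N : Set ℝ}
    (hN : volume (N ∩ Ioo c d) = 0) : ∃ y ∈ Ioo c d, y ∉ N ∧ F y ≤ η := by
  have hv : volume (Ioo c d) = ENNReal.ofReal (d - c) := Real.volume_Ioo
  have hv0 : ENNReal.ofReal (d - c) ≠ 0 := by simpa using hcd
  have hne : volume.restrict (Ioo c d) ≠ 0 := by
    rw [Ne, Measure.restrict_eq_zero, hv]; exact hv0
  obtain ⟨y, hy, hle⟩ := exists_notMem_null_le_laverage hne hF.aemeasurable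
    (N := N ∪ (Ioo c d)ᶜ) (by
      rw [measure_union_null_iff]
      refine ⟨by rwa [Measure.restrict_apply' measurableSet_Ioo], ?_⟩
      rw [Measure.restrict_apply' measurableSet_Ioo]; simp)
  simp only [mem_union, mem_compl_iff, not_or, not_not] at hy
  refine ⟨y, hy.2, hy.1, hle.trans ?_⟩
  rw [setLAverage_eq, hv]
  exact ENNReal.div_le_of_le_mul h

/-- The length-area principle: a function which is square integrable on a box has small integrals
along many horizontal and vertical segments of small boxes. -/
lemma exists_small_lintegral {u : ℝ × ℝ → ℝ≥0∞} (hu : Measurable u) {a : ℝ}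
    (hint : ∫⁻ z in Ioo (-1) 0 ×ˢ Ioo (a - 1) (a + 1), u z ^ 2 ≠ ∞) {η δ₁ : ℝ} (hη : 0 < η)
    (hδ₁ : 0 < δ₁) :
    ∃ δ ∈ Ioo 0 (min δ₁ 1),
      (∀ N : Set ℝ, volume (N ∩ Ioo (a - 1) (a + 1)) = 0 → ∃ y ∈ Ioo (a - δ) a, y ∉ N ∧
        ∫⁻ x in Ioo (-δ) 0, u (x, y) ≤ ENNReal.ofReal η) ∧
      (∀ N : Set ℝ, volume (N ∩ Ioo (a - 1) (a + 1)) = 0 → ∃ y ∈ Ioo a (a + δ), y ∉ N ∧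
        ∫⁻ x in Ioo (-δ) 0, u (x, y) ≤ ENNReal.ofReal η) ∧
      ∃ x ∈ Ioo (-δ) 0, ∫⁻ y in Ioo (a - δ) (a + δ), u (x, y) ≤ ENNReal.ofReal η := by
  set B : ℝ → Set (ℝ × ℝ) := fun δ ↦ Ioo (-δ) 0 ×ˢ Ioo (a - δ) (a + δ) with hB
  have hBm : ∀ δ, MeasurableSet (B δ) := fun δ ↦ measurableSet_Ioo.prod measurableSet_Ioo
  have hvol : ∀ δ, 0 < δ → volume (B δ) = ENNReal.ofReal (2 * δ ^ 2) := by
    intro δ hδ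
    rw [hB, Measure.volume_eq_prod, Measure.prod_prod, Real.volume_Ioo, Real.volume_Ioo,
      ← ENNReal.ofReal_mul (by linarith)]
    congr 1; ring
  have hlim : Tendsto (fun δ ↦ ∫⁻ z in B δ, u z ^ 2 ∂(volume.restrict (B 1))) (𝓝[>] 0) (𝓝 0) := by
    refine tendsto_setLIntegral_zero hint ?_
    have h1 : Tendsto (fun δ : ℝ ↦ ENNReal.ofReal (2 * δ ^ 2)) (𝓝[>] 0) (𝓝 0) := by
      have : Continuous fun δ : ℝ ↦ ENNReal.ofReal (2 * δ ^ 2) :=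
        ENNReal.continuous_ofReal.comp (by fun_prop)
      simpa using (this.tendsto 0).mono_left (nhdsWithin_le_nhds (s := Ioi 0))
    refine tendsto_of_tendsto_of_tendsto_of_le_of_le' tendsto_const_nhds h1
      (Eventually.of_forall fun _ ↦ zero_le) ?_
    filter_upwards [self_mem_nhdsWithin] with δ hδ
    exact (Measure.restrict_apply_le _ _).trans (hvol δ hδ).le
  set e := η / 3 with he
  have he0 : 0 < e := by positivity
  obtain ⟨δ, hsmall, hδ, hδ'⟩ := ((hlim.eventually_lt_const
    (show 0 < ENNReal.ofReal (e ^ 2) from ENNReal.ofReal_pos.2 (by positivity))).and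
    (Ioo_mem_nhdsGT (show 0 < min δ₁ 1 by positivity))).exists
  have hδ1 : δ < 1 := hδ'.trans_le (min_le_right _ _)
  have hBsub : B δ ⊆ B 1 := prod_mono (Ioo_subset_Ioo (by linarith) le_rfl)
    (Ioo_subset_Ioo (by linarith) (by linarith))
  rw [Measure.restrict_restrict (hBm δ), inter_eq_self_of_subset_left hBsub] at hsmall
  have hpt : ∀ t : ℝ≥0∞, t ≤ ENNReal.ofReal (e / δ) + ENNReal.ofReal (δ / e) * t ^ 2 := by
    intro t
    induction t with
    | top => simp [ENNReal.mul_top, he0, hδ]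
    | coe t =>
      rw [← ENNReal.coe_pow, ENNReal.ofReal, ENNReal.ofReal, ← ENNReal.coe_mul, ← ENNReal.coe_add,
        ENNReal.coe_le_coe, ← NNReal.coe_le_coe]
      push_cast
      rw [Real.coe_toNNReal _ (by positivity), Real.coe_toNNReal _ (by positivity),
        ← sub_nonneg]
      have : e / δ + δ / e * (t : ℝ) ^ 2 - t
          = δ / e * (((t : ℝ) - e / δ / 2) ^ 2 + 3 / 4 * (e / δ) ^ 2) := by
        field_simp; ring
      rw [this]; positivity
  have hmain : ∫⁻ z in B δ, u z ≤ ENNReal.ofReal η * ENNReal.ofReal δ := by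
    calc ∫⁻ z in B δ, u z
        ≤ ∫⁻ z in B δ, (ENNReal.ofReal (e / δ) + ENNReal.ofReal (δ / e) * u z ^ 2) :=
          lintegral_mono fun z ↦ hpt _
      _ = ENNReal.ofReal (e / δ) * ENNReal.ofReal (2 * δ ^ 2)
          + ENNReal.ofReal (δ / e) * ∫⁻ z in B δ, u z ^ 2 := by
          rw [lintegral_add_left measurable_const, lintegral_const,
            Measure.restrict_apply_univ, hvol δ hδ, lintegral_const_mul _ (hu.pow_const 2)]
      _ ≤ ENNReal.ofReal (e / δ) * ENNReal.ofReal (2 * δ ^ 2)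
          + ENNReal.ofReal (δ / e) * ENNReal.ofReal (e ^ 2) := by gcongr
      _ = ENNReal.ofReal η * ENNReal.ofReal δ := by
          rw [← ENNReal.ofReal_mul (by positivity), ← ENNReal.ofReal_mul (by positivity),
            ← ENNReal.ofReal_add (by positivity) (by positivity),
            ← ENNReal.ofReal_mul (by positivity)]
          congr 1; rw [he]; field_simp; norm_num
  have hmy : Measurable fun y ↦ ∫⁻ x in Ioo (-δ) 0, u (x, y) := hu.lintegral_prod_left'
  have hmx : Measurable fun x ↦ ∫⁻ y in Ioo (a - δ) (a + δ), u (x, y) := hu.lintegral_prod_right'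
  have hY : ∫⁻ y in Ioo (a - δ) (a + δ), ∫⁻ x in Ioo (-δ) 0, u (x, y)
      ≤ ENNReal.ofReal η * ENNReal.ofReal δ := by
    rw [← setLIntegral_prod_symm _ hu.aemeasurable]; exact hmain
  have hX : ∫⁻ x in Ioo (-δ) 0, ∫⁻ y in Ioo (a - δ) (a + δ), u (x, y)
      ≤ ENNReal.ofReal η * ENNReal.ofReal δ := by
    rw [← setLIntegral_prod _ hu.aemeasurable]; exact hmain
  refine ⟨δ, ⟨hδ, hδ'⟩, fun N hN ↦ ?_, fun N hN ↦ ?_, ?_⟩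
  · refine exists_notMem_lintegral_le hmy (by linarith) ?_
      (measure_mono_null (inter_subset_inter_right _ (Ioo_subset_Ioo (by linarith) (by linarith))) hN)
    rw [show a - (a - δ) = δ by ring]
    exact (lintegral_mono_set (Ioo_subset_Ioo le_rfl (by linarith))).trans hY
  · refine exists_notMem_lintegral_le hmy (by linarith) ?_
      (measure_mono_null (inter_subset_inter_right _ (Ioo_subset_Ioo (by linarith) (by linarith))) hN)
    rw [show a + δ - a = δ by ring]
    exact (lintegral_mono_set (Ioo_subset_Ioo (by linarith) le_rfl)).trans hY
  · obtain ⟨x, hx, -, h⟩ := exists_notMem_lintegral_le (c := -δ) (d := 0) (N := ∅) hmx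
      (by linarith) (by rwa [show (0:ℝ) - -δ = δ by ring]) (by simp)
    exact ⟨x, hx, h⟩

/-- The oscillation of a curve is bounded by its length. -/
lemma dist_le_of_lintegral_enorm_deriv_le {c : ℝ → ℂ} {s t a b η : ℝ} (hη : 0 ≤ η)
    (hc : ContDiffOn ℝ 1 c (Ioo a b))
    (hint : ∫⁻ x in Ioo a b, ‖deriv c x‖ₑ ≤ ENNReal.ofReal η) (hs : s ∈ Ioo a b)
    (ht : t ∈ Ioo a b) : dist (c s) (c t) ≤ η := by
  wlog hst : s ≤ t generalizing s t
  · rw [dist_comm]; exact this ht hs (le_of_not_ge hst)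
  have hsub : Icc s t ⊆ Ioo a b := Icc_subset_Ioo hs.1 ht.2
  have h := enorm_sub_le_lintegral_deriv_of_contDiffOn_Icc (hc.mono hsub) hst
  have h2 := (h.trans (lintegral_mono_set hsub)).trans hint
  rw [← ofReal_norm, ENNReal.ofReal_le_ofReal_iff hη] at h2
  rwa [dist_comm, dist_eq_norm]

/-- A curve of finite length converges at the end. -/
lemma exists_tendsto_of_lintegral_enorm_deriv_ne_top {c : ℝ → ℂ} {a b : ℝ} (hab : a < b)
    (hc : ContDiffOn ℝ 1 c (Ioo a b))
    (hint : ∫⁻ x in Ioo a b, ‖deriv c x‖ₑ ≠ ∞) :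
    ∃ p, Tendsto c (𝓝[<] b) (𝓝 p) := by
  have hlim : Tendsto (fun s ↦ ∫⁻ x in Ioo s b, ‖deriv c x‖ₑ ∂(volume.restrict (Ioo a b)))
      (𝓝[<] b) (𝓝 0) := by
    refine tendsto_setLIntegral_zero hint ?_
    have h1 : Tendsto (fun s : ℝ ↦ ENNReal.ofReal (b - s)) (𝓝[<] b) (𝓝 0) := by
      have : Continuous fun s : ℝ ↦ ENNReal.ofReal (b - s) :=
        ENNReal.continuous_ofReal.comp (by fun_prop)
      simpa using (this.tendsto b).mono_left (nhdsWithin_le_nhds (s := Iio b))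
    refine tendsto_of_tendsto_of_tendsto_of_le_of_le tendsto_const_nhds h1
      (fun _ ↦ zero_le) fun s ↦ ?_
    exact (Measure.restrict_apply_le _ _).trans Real.volume_Ioo.le
  refine cauchy_map_iff_exists_tendsto.1 (Metric.cauchy_iff.2 ⟨inferInstance, fun ε hε ↦ ?_⟩)
  obtain ⟨s, hs, has, hsb⟩ := ((hlim.eventually_lt_const
    (show 0 < ENNReal.ofReal (ε / 2) from ENNReal.ofReal_pos.2 (by positivity))).and
    (Ioo_mem_nhdsLT hab)).exists
  rw [Measure.restrict_restrict measurableSet_Ioo,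
    inter_eq_self_of_subset_left (Ioo_subset_Ioo has.le le_rfl)] at hs
  refine ⟨c '' Ioo s b, image_mem_map (Ioo_mem_nhdsLT hsb), ?_⟩
  rintro _ ⟨x, hx, rfl⟩ _ ⟨y, hy, rfl⟩
  exact (dist_le_of_lintegral_enorm_deriv_le (by positivity)
    (hc.mono (Ioo_subset_Ioo has.le le_rfl)) hs.le hx hy).trans_lt (half_lt_self hε)

end LengthArea

section BoundaryUniqueness

open Set Filter Topology Metric Complex MeasureTheory InnerProductSpace
open scoped ENNReal

/-- A bounded holomorphic function on the disc omitting the value `q` has radial limit `q` only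
on a null set of directions. -/
lemma ae_not_tendsto_radial {f : ℂ → ℂ} (hf : DifferentiableOn ℂ f (ball 0 1))
    (hb : Bornology.IsBounded (f '' ball 0 1)) {q : ℂ} (hq : ∀ z ∈ ball (0 : ℂ) 1, f z ≠ q) (a : ℝ) :
    volume ({y : ℝ | Tendsto (fun x : ℝ ↦ f (exp (x + y * I))) (𝓝[<] 0) (𝓝 q)} ∩
      Ioo (a - 1) (a + 1)) = 0 := by
  obtain ⟨M, hM⟩ := hb.exists_norm_le
  set v : ℂ → ℝ := fun z ↦ Real.log ‖f z - q‖ with hv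
  set C : ℝ := M + ‖q‖ with hC
  have hvC : ∀ z ∈ ball (0 : ℂ) 1, v z ≤ C := fun z hz ↦ by
    have := norm_sub_le (f z) q
    have := hM _ (mem_image_of_mem f hz)
    have := Real.log_le_sub_one_of_pos (norm_pos_iff.2 (sub_ne_zero.2 (hq z hz)))
    simp only [hv]; linarith
  have hharm : HarmonicOnNhd v (ball 0 1) := fun z hz ↦
    ((hf.analyticAt (isOpen_ball.mem_nhds hz)).sub analyticAt_const).harmonicAt_log_norm
      (sub_ne_zero.2 (hq z hz))
  have hvc : ContinuousOn v (ball 0 1) := hharm.continuousOn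
  have hball : ∀ x y : ℝ, x < 0 → exp (x + y * I) ∈ ball (0 : ℂ) 1 := fun x y hx ↦ by
    simpa [Complex.norm_exp] using hx
  set x : ℕ → ℝ := fun n ↦ -(1 / ((n : ℝ) + 1)) with hx
  have hx0 : ∀ n, x n < 0 := fun n ↦ neg_lt_zero.2 Nat.one_div_pos_of_nat
  have hxlim : Tendsto x atTop (𝓝[<] 0) := by
    refine tendsto_nhdsWithin_iff.2 ⟨?_, Eventually.of_forall hx0⟩
    simpa [hx] using (tendsto_one_div_add_atTop_nhds_zero_nat (𝕜 := ℝ)).neg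
  set u : ℕ → ℝ → ℝ := fun n y ↦ C - v (exp (x n + y * I)) with hu
  have huc : ∀ n, Continuous (u n) := fun n ↦ continuous_const.sub
    (hvc.comp_continuous (by fun_prop) fun y ↦ hball _ _ (hx0 n))
  have huint : ∀ n, ∫ y in Ioc (a - Real.pi) (a - Real.pi + 2 * Real.pi), u n y
      = 2 * Real.pi * (C - v 0) := by
    intro n
    have hper : Function.Periodic (u n) (2 * Real.pi) := fun y ↦ by
      simp only [hu]
      push_cast
      rw [add_mul, ← add_assoc, Complex.exp_periodic]
    rw [← intervalIntegral.integral_of_le (by linarith [Real.pi_pos]),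
      hper.intervalIntegral_add_eq _ 0, zero_add]
    have hR : |Real.exp (x n)| < 1 := by
      rw [abs_of_pos (Real.exp_pos _)]; simpa using hx0 n
    have hh : HarmonicOnNhd v (closedBall 0 |Real.exp (x n)|) :=
      fun z hz ↦ hharm z (closedBall_subset_ball hR hz)
    have h := hh.circleAverage_eq
    rw [Real.circleAverage_def] at h
    have h2 : ∀ y : ℝ, u n y = C - v (circleMap 0 (Real.exp (x n)) y) := fun y ↦ by
      simp only [hu, circleMap, zero_add, ofReal_exp, exp_add]
    simp_rw [h2]
    rw [intervalIntegral.integral_sub (by simp)]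
    · rw [smul_eq_mul, inv_mul_eq_iff_eq_mul₀ (by positivity)] at h
      rw [h]; simp; ring
    · refine ContinuousOn.intervalIntegrable (hvc.comp (continuous_circleMap _ _).continuousOn
        fun y _ ↦ ?_)
      simpa using hR
  set S := Ioc (a - Real.pi) (a - Real.pi + 2 * Real.pi) with hS
  have hfatou : ∫⁻ y in S, liminf (fun n ↦ ENNReal.ofReal (u n y)) atTop
      ≤ ENNReal.ofReal (2 * Real.pi * (C - v 0)) := by
    refine (lintegral_liminf_le fun n ↦ (huc n).measurable.ennreal_ofReal).trans ?_
    have : ∀ n, ∫⁻ y in S, ENNReal.ofReal (u n y) = ENNReal.ofReal (2 * Real.pi * (C - v 0)) := by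
      intro n
      rw [← huint n, ofReal_integral_eq_lintegral_ofReal]
      · exact (huc n).integrableOn_Ioc
      · exact Eventually.of_forall fun y ↦ sub_nonneg.2 (hvC _ (hball _ _ (hx0 n)))
    simp [this]
  have hae := ae_lt_top (Measurable.liminf fun n ↦ (huc n).measurable.ennreal_ofReal)
    (ne_top_of_le_ne_top ENNReal.ofReal_ne_top hfatou)
  rw [ae_iff, Measure.restrict_apply' measurableSet_Ioc] at hae
  refine measure_mono_null ?_ hae
  rintro y ⟨hy, hya⟩
  refine ⟨?_, ?_⟩
  · have h1 : Tendsto (fun n ↦ ‖f (exp (x n + y * I)) - q‖) atTop (𝓝[≠] 0) := by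
      refine tendsto_nhdsWithin_iff.2 ⟨?_, Eventually.of_forall fun n ↦
        (norm_pos_iff.2 (sub_ne_zero.2 (hq _ (hball _ _ (hx0 n))))).ne'⟩
      have := ((hy.comp hxlim).sub_const q).norm
      simpa using this
    have h2 : Tendsto (fun n ↦ u n y) atTop atTop :=
      tendsto_atTop_add_const_left _ _ (tendsto_neg_atBot_atTop.comp
        (Real.tendsto_log_nhdsNE_zero.comp h1))
    have h3 := (ENNReal.tendsto_ofReal_atTop.comp h2).liminf_eq
    simp only [Function.comp_def] at h3
    simp [h3]
  · have := Real.pi_gt_three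
    exact ⟨by linarith [hya.1], by linarith [hya.2]⟩

end BoundaryUniqueness

section CrosscutNeighborhood

open Set Filter Topology Metric Complex

/-- `f` is a conformal map from the unit disc onto `W` with inverse `φ` and `f 0 = w`. -/
structure IsRiemannMap (W : Set ℂ) (w : ℂ) (f φ : ℂ → ℂ) : Prop where
  isOpen : IsOpen W
  differentiableOn : DifferentiableOn ℂ f (ball 0 1)
  continuousOn_inv : ContinuousOn φ W
  mapsTo : MapsTo f (ball 0 1) W
  mapsTo_inv : MapsTo φ W (ball 0 1)
  left_inv : LeftInvOn φ f (ball 0 1)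
  right_inv : LeftInvOn f φ W
  map_zero : f 0 = w

/-- The open box in the left half-plane with one side on the imaginary axis. -/
def openBox (α β h : ℝ) : Set ℂ := Ioo (-h) 0 ×ℂ Ioo α β

/-- The box in the left half-plane which contains all its sides but the one on the imaginary
axis. -/
def halfBox (α β h : ℝ) : Set ℂ := Ico (-h) 0 ×ℂ Icc α β

lemma mem_openBox {α β h : ℝ} {z : ℂ} :
    z ∈ openBox α β h ↔ (-h < z.re ∧ z.re < 0) ∧ α < z.im ∧ z.im < β := Iff.rfl

lemma mem_halfBox {α β h : ℝ} {z : ℂ} :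
    z ∈ halfBox α β h ↔ (-h ≤ z.re ∧ z.re < 0) ∧ α ≤ z.im ∧ z.im ≤ β := Iff.rfl

lemma openBox_subset_halfBox (α β h : ℝ) : openBox α β h ⊆ halfBox α β h :=
  fun _ hz ↦ ⟨⟨hz.1.1.le, hz.1.2⟩, hz.2.1.le, hz.2.2.le⟩

lemma isOpen_openBox (α β h : ℝ) : IsOpen (openBox α β h) := isOpen_Ioo.reProdIm isOpen_Ioo

lemma exp_mem_ball_iff {z : ℂ} : exp z ∈ ball (0 : ℂ) 1 ↔ z.re < 0 := by
  simp [Complex.norm_exp]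

lemma eq_of_exp_eq_exp {z z' : ℂ} (h : exp z = exp z') (him : |z.im - z'.im| < 2 * Real.pi) :
    z = z' := by
  obtain ⟨n, hn⟩ := exp_eq_exp_iff_exists_int.1 h
  have h1 : z.im - z'.im = n * (2 * Real.pi) := by rw [hn]; simp
  rw [h1, abs_mul, abs_of_pos Real.two_pi_pos] at him
  have h2 : |(n : ℝ)| < 1 := by
    by_contra! h3
    nlinarith [Real.two_pi_pos]
  have h3 : n = 0 := by
    rw [← Int.cast_abs] at h2
    exact Int.abs_lt_one_iff.1 (by exact_mod_cast h2)
  simpa [h3] using hn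

lemma exp_image_halfBox (α β h : ℝ) :
    exp '' halfBox α β h = ball 0 1 ∩ exp '' (Icc (-h) 0 ×ℂ Icc α β) := by
  ext ζ
  constructor
  · rintro ⟨z, hz, rfl⟩
    exact ⟨exp_mem_ball_iff.2 hz.1.2, z, ⟨⟨hz.1.1, hz.1.2.le⟩, hz.2⟩, rfl⟩
  · rintro ⟨hζ, z, hz, rfl⟩
    exact ⟨z, ⟨⟨hz.1.1, exp_mem_ball_iff.1 hζ⟩, hz.2⟩, rfl⟩

namespace IsRiemannMap

variable {W : Set ℂ} {w : ℂ} {f φ : ℂ → ℂ}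

lemma mem_frontier_iff {q : ℂ} (hf : IsRiemannMap W w f φ) :
    q ∈ frontier W ↔ q ∈ closure W ∧ q ∉ W := by
  rw [hf.isOpen.frontier_eq, Set.mem_sdiff]

lemma image_ball (hf : IsRiemannMap W w f φ) : f '' ball 0 1 = W :=
  hf.mapsTo.image_subset.antisymm fun z hz ↦ ⟨φ z, hf.mapsTo_inv hz, hf.right_inv hz⟩

lemma injOn (hf : IsRiemannMap W w f φ) : InjOn f (ball 0 1) := hf.left_inv.injOn

lemma isOpen_image (hf : IsRiemannMap W w f φ) {V : Set ℂ} (hV : IsOpen V)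
    (hVs : V ⊆ ball 0 1) : IsOpen (f '' V) := by
  have : f '' V = W ∩ φ ⁻¹' V := by
    ext z
    constructor
    · rintro ⟨ζ, hζ, rfl⟩
      exact ⟨hf.mapsTo (hVs hζ), by rwa [mem_preimage, hf.left_inv (hVs hζ)]⟩
    · rintro ⟨hz, hz'⟩
      exact ⟨φ z, hz', hf.right_inv hz⟩
  rw [this]
  exact hf.continuousOn_inv.isOpen_inter_preimage hf.isOpen hV

lemma injOn_comp_exp (hf : IsRiemannMap W w f φ) {α β h : ℝ} (hαβ : β - α < 2 * Real.pi) :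
    InjOn (fun z ↦ f (exp z)) (halfBox α β h) := fun z hz z' hz' h ↦ by
  refine eq_of_exp_eq_exp (hf.injOn (exp_mem_ball_iff.2 hz.1.2) (exp_mem_ball_iff.2 hz'.1.2) h) ?_
  have h1 := hz.2
  have h2 := hz'.2
  rw [abs_lt]
  constructor <;> linarith [h1.1, h1.2, h2.1, h2.2]

lemma base_notMem_image (hf : IsRiemannMap W w f φ) {s : Set ℂ} (hs : ∀ z ∈ s, z.re < 0) :
    w ∉ (fun z ↦ f (exp z)) '' s := by
  rintro ⟨z, hz, h⟩
  rw [← hf.map_zero] at h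
  exact exp_ne_zero z (hf.injOn (exp_mem_ball_iff.2 (hs z hz)) (by simp) h)

/-- The crosscut neighborhood of the image of three sides of a box is the image of the box. -/
lemma crosscutNbhd_eq (hf : IsRiemannMap W w f φ) {α β h : ℝ} (hαβ : β - α < 2 * Real.pi)
    {γ : ℝ → ℂ}
    (hγ : γ '' Ioo 0 1 = (fun z ↦ f (exp z)) '' (halfBox α β h \ openBox α β h)) :
    crosscutNbhd W w γ = (fun z ↦ f (exp z)) '' openBox α β h := by
  set g : ℂ → ℂ := fun z ↦ f (exp z) with hg
  have hre : ∀ z ∈ halfBox α β h, z.re < 0 := fun z hz ↦ hz.1.2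
  have hreo : ∀ z ∈ openBox α β h, z.re < 0 := fun z hz ↦ hz.1.2
  have hopen : IsOpen (g '' openBox α β h) := by
    have : g '' openBox α β h = f '' (exp '' openBox α β h) := by rw [image_image]
    rw [this]
    refine hf.isOpen_image (isOpenMap_exp _ (isOpen_openBox α β h)) ?_
    rintro _ ⟨z, hz, rfl⟩
    exact exp_mem_ball_iff.2 (hreo z hz)
  have hout : W \ g '' halfBox α β h = f '' (ball 0 1 \ exp '' (Icc (-h) 0 ×ℂ Icc α β)) := by
    have : g '' halfBox α β h = f '' (exp '' halfBox α β h) := by rw [image_image]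
    rw [this, exp_image_halfBox, ← hf.image_ball, ← hf.injOn.image_sdiff_subset inter_subset_left,
      sdiff_self_inter]
  have hout_open : IsOpen (W \ g '' halfBox α β h) := by
    rw [hout]
    refine hf.isOpen_image (isOpen_ball.sdiff ?_) sdiff_subset
    exact (((isCompact_Icc.reProdIm isCompact_Icc).image continuous_exp)).isClosed
  have hgW : MapsTo g (halfBox α β h) W := fun z hz ↦ hf.mapsTo (exp_mem_ball_iff.2 (hre z hz))
  unfold crosscutNbhd
  rw [hγ]
  ext z
  constructor
  · rintro ⟨⟨hzW, hzU⟩, hwz⟩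
    by_contra hzB
    refine hwz ?_
    have hzH : z ∉ g '' halfBox α β h := by
      rintro ⟨u, hu, rfl⟩
      by_cases huB : u ∈ openBox α β h
      · exact hzB ⟨u, huB, rfl⟩
      · exact hzU ⟨u, ⟨hu, huB⟩, rfl⟩
    set ζ := φ z with hζ
    have hζb : ζ ∈ ball (0 : ℂ) 1 := hf.mapsTo_inv hzW
    have hfζ : f ζ = z := hf.right_inv hzW
    have hseg : MapsTo (fun t : ℝ ↦ (t : ℂ) * ζ) (Icc 0 1) (ball 0 1) := by
      intro t ht
      rw [mem_ball_zero_iff] at hζb ⊢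
      rw [norm_mul, norm_real, Real.norm_of_nonneg ht.1]
      nlinarith [ht.2, norm_nonneg ζ]
    have hpre : IsPreconnected ((fun t : ℝ ↦ f (t * ζ)) '' Icc 0 1) :=
      isPreconnected_Icc.image _ (hf.differentiableOn.continuousOn.comp (by fun_prop) hseg)
    refine hpre.subset_connectedComponentIn (x := z) ⟨1, by simp, by simp [hfζ]⟩ ?_
      ⟨0, by simp, by simp [hf.map_zero]⟩
    rintro _ ⟨t, ht, rfl⟩
    refine ⟨hf.mapsTo (hseg ht), ?_⟩
    rintro ⟨u, ⟨hu, -⟩, hut⟩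
    have h1 : exp u = t * ζ := hf.injOn (exp_mem_ball_iff.2 (hre u hu)) (hseg ht) hut
    have ht0 : 0 < t := ht.1.lt_of_ne (by rintro rfl; simp at h1)
    have h2 : exp (u - Real.log t) = ζ := by
      rw [exp_sub, h1, ← ofReal_exp, Real.exp_log ht0,
        mul_div_cancel_left₀ _ (ofReal_ne_zero.2 ht0.ne')]
    refine hzH ⟨u - Real.log t, ?_, ?_⟩
    · have h3 : (u - Real.log t).re < 0 := by rwa [← exp_mem_ball_iff, h2]
      have h4 := Real.log_nonpos ht0.le ht.2
      rw [mem_halfBox] at hu ⊢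
      refine ⟨⟨?_, h3⟩, ?_⟩
      · simp only [sub_re, ofReal_re]; linarith [hu.1.1]
      · simpa using hu.2
    · simp only [hg, h2, hfζ]
  · rintro ⟨u, hu, rfl⟩
    have huX : g u ∈ W \ g '' (halfBox α β h \ openBox α β h) := by
      refine ⟨hgW (openBox_subset_halfBox _ _ _ hu), ?_⟩
      rintro ⟨v, ⟨hv, hv'⟩, hvu⟩
      rw [hf.injOn_comp_exp hαβ hv (openBox_subset_halfBox _ _ _ hu) hvu] at hv'
      exact hv' hu
    refine ⟨huX, fun hw ↦ ?_⟩
    have hsub : connectedComponentIn (W \ g '' (halfBox α β h \ openBox α β h)) (g u)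
        ⊆ g '' openBox α β h := by
      refine isPreconnected_connectedComponentIn.subset_left_of_subset_union hopen hout_open ?_ ?_
        ⟨g u, mem_connectedComponentIn huX, u, hu, rfl⟩
      · rw [Set.disjoint_left]
        rintro _ ⟨v, hv, rfl⟩ hv'
        exact hv'.2 ⟨v, openBox_subset_halfBox _ _ _ hv, rfl⟩
      · refine (connectedComponentIn_subset _ _).trans ?_
        rintro z ⟨hzW, hz⟩
        by_cases hzB : z ∈ g '' openBox α β h
        · exact Or.inl hzB
        · refine Or.inr ⟨hzW, ?_⟩
          rintro ⟨v, hv, rfl⟩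
          exact hz ⟨v, ⟨hv, fun h ↦ hzB ⟨v, h, rfl⟩⟩, rfl⟩
    exact hf.base_notMem_image hreo (hsub hw)

end IsRiemannMap

end CrosscutNeighborhood

section BoxPath

open Set Filter Topology Metric Complex

/-- A parametrization of the three sides of the box which do not lie on the imaginary axis. -/
noncomputable def boxPath (α β h t : ℝ) : ℂ :=
  ((-(h * min 1 (min (3 * t) (3 * (1 - t)))) : ℝ) : ℂ)
    + ((α + (β - α) * max 0 (min 1 (3 * t - 1)) : ℝ) : ℂ) * I

lemma continuous_boxPath (α β h : ℝ) : Continuous (boxPath α β h) := by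
  unfold boxPath; fun_prop

lemma boxPath_of_le {α β h t : ℝ} (ht : 3 * t ≤ 1) :
    boxPath α β h t = ((-(h * (3 * t)) : ℝ) : ℂ) + α * I := by
  rw [boxPath, min_eq_left (a := 3 * t) (by linarith), min_eq_right ht,
    max_eq_left ((min_le_right _ _).trans (by linarith))]
  simp

lemma boxPath_of_mem {α β h t : ℝ} (ht : 1 ≤ 3 * t) (ht' : 3 * t ≤ 2) :
    boxPath α β h t = ((-h : ℝ) : ℂ) + ((α + (β - α) * (3 * t - 1) : ℝ) : ℂ) * I := by
  rw [boxPath, min_eq_left (le_min ht (by linarith)), min_eq_right (by linarith),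
    max_eq_right (by linarith)]
  simp

lemma boxPath_of_ge {α β h t : ℝ} (ht : 2 ≤ 3 * t) :
    boxPath α β h t = ((-(h * (3 * (1 - t))) : ℝ) : ℂ) + β * I := by
  rw [boxPath, min_eq_right (a := 3 * t) (by linarith), min_eq_right (a := (1 : ℝ)) (by linarith),
    min_eq_left (by linarith), max_eq_right zero_le_one]
  simp

lemma boxPath_cases (t : ℝ) : 3 * t ≤ 1 ∨ (1 < 3 * t ∧ 3 * t < 2) ∨ 2 ≤ 3 * t := by
  grind

lemma injective_boxPath {α β h : ℝ} (hαβ : α < β) (hh : 0 < h) :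
    Function.Injective (boxPath α β h) := by
  intro t s hts
  have hβα : β - α ≠ 0 := (sub_pos.2 hαβ).ne'
  have hre : min 1 (min (3 * t) (3 * (1 - t))) = min 1 (min (3 * s) (3 * (1 - s))) := by
    simpa [boxPath, hh.ne'] using congrArg re hts
  have him : max 0 (min 1 (3 * t - 1)) = max 0 (min 1 (3 * s - 1)) := by
    simpa [boxPath, hβα] using congrArg im hts
  grind

lemma image_boxPath {α β h : ℝ} (hαβ : α < β) (hh : 0 < h) :
    boxPath α β h '' Ioo 0 1 = halfBox α β h \ openBox α β h := by
  have hβα : 0 < β - α := sub_pos.2 hαβ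
  ext z
  constructor
  · rintro ⟨t, ht, rfl⟩
    obtain ⟨h0, h1⟩ := ht
    rw [Set.mem_sdiff, mem_halfBox, mem_openBox]
    rcases boxPath_cases t with ht | ⟨ht, ht'⟩ | ht
    · rw [boxPath_of_le ht]
      simp
      constructorm* _ ∧ _ <;> nlinarith
    · rw [boxPath_of_mem ht.le ht'.le]
      simp
      refine ⟨?_, ?_, ?_⟩ <;> nlinarith
    · rw [boxPath_of_ge ht]
      simp
      constructorm* _ ∧ _ <;> nlinarith
  · rintro ⟨hz, hz'⟩
    rw [mem_halfBox] at hz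
    obtain ⟨⟨hr, hr'⟩, hi, hi'⟩ := hz
    rcases hi.eq_or_lt with hα | hα
    · have ht : 3 * (-z.re / (3 * h)) = -z.re / h := by field_simp
      have h1 : -z.re / h ≤ 1 := by rw [div_le_one hh]; linarith
      have h2 : 0 < -z.re / h := div_pos (by linarith) hh
      refine ⟨-z.re / (3 * h), ⟨by linarith, by linarith⟩, ?_⟩
      rw [boxPath_of_le (by rw [ht]; exact h1), ht, mul_div_cancel₀ _ hh.ne']
      apply Complex.ext <;> simp [hα]
    rcases hi'.eq_or_lt with hβ | hβ
    · have ht : 3 * (-z.re / (3 * h)) = -z.re / h := by field_simp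
      have h1 : -z.re / h ≤ 1 := by rw [div_le_one hh]; linarith
      have h2 : 0 < -z.re / h := div_pos (by linarith) hh
      refine ⟨1 - -z.re / (3 * h), ⟨by linarith, by linarith⟩, ?_⟩
      rw [boxPath_of_ge (by linarith), sub_sub_cancel, ht, mul_div_cancel₀ _ hh.ne']
      apply Complex.ext <;> simp [hβ]
    · have hre : z.re = -h := by
        by_contra hne
        exact hz' ⟨⟨lt_of_le_of_ne hr (Ne.symm hne), hr'⟩, hα, hβ⟩
      have ht : 3 * ((1 + (z.im - α) / (β - α)) / 3) = 1 + (z.im - α) / (β - α) := by ring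
      have h1 : (z.im - α) / (β - α) < 1 := by rw [div_lt_one hβα]; linarith
      have h2 : 0 < (z.im - α) / (β - α) := div_pos (by linarith) hβα
      refine ⟨(1 + (z.im - α) / (β - α)) / 3, ⟨by linarith, by linarith⟩, ?_⟩
      rw [boxPath_of_mem (by linarith) (by linarith), ht, add_sub_cancel_left,
        mul_div_cancel₀ _ hβα.ne']
      apply Complex.ext <;> simp [hre]

end BoxPath

section SmallCrosscuts

open Set Filter Topology Metric Complex MeasureTheory
open scoped ENNReal

namespace IsRiemannMap

variable {W : Set ℂ} {w : ℂ} {f φ : ℂ → ℂ}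

lemma differentiableOn_comp_exp (hf : IsRiemannMap W w f φ) :
    DifferentiableOn ℂ (fun z ↦ f (exp z)) {z | z.re < 0} :=
  hf.differentiableOn.comp differentiable_exp.differentiableOn fun _ hz ↦ exp_mem_ball_iff.2 hz

lemma isOpen_re_neg : IsOpen {z : ℂ | z.re < 0} := isOpen_Iio.preimage continuous_re

lemma contDiffOn_comp_exp (hf : IsRiemannMap W w f φ) {c : ℝ → ℂ} (hc : ContDiff ℝ 1 c)
    {s : Set ℝ} (hs : ∀ x ∈ s, (c x).re < 0) : ContDiffOn ℝ 1 (fun x ↦ f (exp (c x))) s :=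
  ContDiffOn.comp (t := {z : ℂ | z.re < 0}) (g := fun z ↦ f (exp z))
    ((hf.differentiableOn_comp_exp.contDiffOn isOpen_re_neg).restrict_scalars ℝ)
    hc.contDiffOn hs

lemma enorm_deriv_comp_exp (hf : IsRiemannMap W w f φ) {c : ℝ → ℂ} {c' : ℂ} {x : ℝ}
    (hc : HasDerivAt c c' x) (hc' : ‖c'‖ₑ = 1) (hx : (c x).re < 0) :
    ‖deriv (fun x ↦ f (exp (c x))) x‖ₑ = ‖deriv (fun z ↦ f (exp z)) (c x)‖ₑ := by
  have h := ((hf.differentiableOn_comp_exp.differentiableAt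
    (isOpen_re_neg.mem_nhds hx)).hasDerivAt.comp x hc).deriv
  simp only [Function.comp_def] at h
  rw [h, enorm_mul, hc', mul_one]

lemma setLIntegral_enorm_deriv_sq_ne_top (hf : IsRiemannMap W w f φ) (hW : Bornology.IsBounded W)
    (a : ℝ) :
    ∫⁻ p : ℝ × ℝ in Ioo (-1) 0 ×ˢ Ioo (a - 1) (a + 1),
      ‖deriv (fun z ↦ f (exp z)) (p.1 + p.2 * I)‖ₑ ^ 2 ≠ ∞ := by
  have hsub := openBox_subset_halfBox (a - 1) (a + 1) 1
  have hre : openBox (a - 1) (a + 1) 1 ⊆ {z | z.re < 0} := fun z hz ↦ hz.1.2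
  have h := setLIntegral_enorm_deriv_sq (isOpen_openBox (a - 1) (a + 1) 1)
    (hf.differentiableOn_comp_exp.mono hre) ((hf.injOn_comp_exp (by
      have := Real.pi_gt_three; linarith)).mono hsub)
  rw [← volume_preserving_equiv_real_prod.symm.setLIntegral_comp_preimage
    (isOpen_openBox _ _ _).measurableSet ((measurable_deriv _).enorm.pow_const 2)] at h
  have h2 : measurableEquivRealProd.symm ⁻¹' openBox (a - 1) (a + 1) 1
      = Ioo (-1) 0 ×ˢ Ioo (a - 1) (a + 1) := rfl
  rw [h2] at h
  have h3 : ∀ p : ℝ × ℝ, measurableEquivRealProd.symm p = (p.1 : ℂ) + p.2 * I := fun p ↦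
    Complex.mk_eq_add_mul_I _ _
  simp_rw [h3] at h
  rw [h]
  refine ne_top_of_le_ne_top hW.measure_lt_top.ne (measure_mono ?_)
  rintro _ ⟨z, hz, rfl⟩
  exact hf.mapsTo (exp_mem_ball_iff.2 (hre hz))

lemma mem_frontier_of_tendsto (hf : IsRiemannMap W w f φ) {y : ℝ} {p : ℂ}
    (h : Tendsto (fun x : ℝ ↦ f (exp (x + y * I))) (𝓝[<] 0) (𝓝 p)) : p ∈ frontier W := by
  have hball : ∀ᶠ x : ℝ in 𝓝[<] 0, exp (x + y * I) ∈ ball (0 : ℂ) 1 := by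
    filter_upwards [self_mem_nhdsWithin] with x hx
    rw [exp_mem_ball_iff]; simpa using hx
  refine hf.mem_frontier_iff.2 ⟨mem_closure_of_tendsto h (hball.mono fun x hx ↦ hf.mapsTo hx), ?_⟩
  intro hp
  have h1 : Tendsto (fun x : ℝ ↦ φ (f (exp (x + y * I)))) (𝓝[<] 0) (𝓝 (φ p)) :=
    ((hf.continuousOn_inv.continuousAt (hf.isOpen.mem_nhds hp)).tendsto).comp h
  have h2 : Tendsto (fun x : ℝ ↦ exp (x + y * I)) (𝓝[<] 0) (𝓝 (exp ((0 : ℝ) + y * I))) := by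
    have : Continuous fun x : ℝ ↦ exp (x + y * I) := by fun_prop
    exact (this.tendsto 0).mono_left nhdsWithin_le_nhds
  have h3 := tendsto_nhds_unique (h1.congr' (hball.mono fun x hx ↦ hf.left_inv hx)) h2
  have h4 := hf.mapsTo_inv hp
  rw [h3, exp_mem_ball_iff] at h4
  simp at h4

/-- The image of three sides of a box is a crosscut if the images of the horizontal sides converge
to distinct boundary points. -/
lemma exists_isCrosscut (hf : IsRiemannMap W w f φ) {α β h : ℝ} (hαβ : α < β)
    (hβα : β - α < 2 * Real.pi) (hh : 0 < h) {p q : ℂ}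
    (hp : Tendsto (fun x : ℝ ↦ f (exp (x + α * I))) (𝓝[<] 0) (𝓝 p))
    (hq : Tendsto (fun x : ℝ ↦ f (exp (x + β * I))) (𝓝[<] 0) (𝓝 q)) (hpq : p ≠ q) :
    ∃ γ, IsCrosscut W γ ∧ γ 0 = p ∧ γ 1 = q ∧
      γ '' Ioo 0 1 = (fun z ↦ f (exp z)) '' (halfBox α β h \ openBox α β h) := by
  set c : ℝ → ℂ := fun t ↦ f (exp (boxPath α β h t)) with hc
  have hmem : ∀ t ∈ Ioo (0 : ℝ) 1, boxPath α β h t ∈ halfBox α β h := fun t ht ↦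
    ((image_boxPath hαβ hh).subset ⟨t, ht, rfl⟩).1
  have hball : ∀ t ∈ Ioo (0 : ℝ) 1, exp (boxPath α β h t) ∈ ball (0 : ℂ) 1 := fun t ht ↦
    exp_mem_ball_iff.2 (hmem t ht).1.2
  have hcc : ContinuousOn c (Ioo 0 1) := hf.differentiableOn.continuousOn.comp
    (continuous_exp.comp (continuous_boxPath α β h)).continuousOn hball
  have h0 : Tendsto c (𝓝[>] 0) (𝓝 p) := by
    have h1 : Tendsto (fun t : ℝ ↦ -(h * (3 * t))) (𝓝[>] 0) (𝓝[<] 0) := by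
      refine tendsto_nhdsWithin_iff.2 ⟨?_, ?_⟩
      · have : Continuous fun t : ℝ ↦ -(h * (3 * t)) := by fun_prop
        simpa using (this.tendsto 0).mono_left (nhdsWithin_le_nhds (s := Ioi 0))
      · filter_upwards [self_mem_nhdsWithin] with t ht
        have : 0 < t := ht
        have : 0 < h * (3 * t) := by positivity
        simpa using this
    refine (hp.comp h1).congr' ?_
    filter_upwards [Ioo_mem_nhdsGT (show (0 : ℝ) < 1 / 3 by norm_num)] with t ht
    rw [hc, Function.comp_apply]
    simp only
    rw [boxPath_of_le (by linarith [ht.2])]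
  have h1 : Tendsto c (𝓝[<] 1) (𝓝 q) := by
    have h1 : Tendsto (fun t : ℝ ↦ -(h * (3 * (1 - t)))) (𝓝[<] 1) (𝓝[<] 0) := by
      refine tendsto_nhdsWithin_iff.2 ⟨?_, ?_⟩
      · have : Continuous fun t : ℝ ↦ -(h * (3 * (1 - t))) := by fun_prop
        simpa using (this.tendsto 1).mono_left (nhdsWithin_le_nhds (s := Iio 1))
      · filter_upwards [self_mem_nhdsWithin] with t ht
        have : 0 < 1 - t := sub_pos.2 ht
        have : 0 < h * (3 * (1 - t)) := by positivity
        rw [mem_Iio]; linarith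
    refine (hq.comp h1).congr' ?_
    filter_upwards [Ioo_mem_nhdsLT (show (2 / 3 : ℝ) < 1 by norm_num)] with t ht
    rw [hc, Function.comp_apply]
    simp only
    rw [boxPath_of_ge (by linarith [ht.1])]
  set γ := extendFrom (Ioo (0 : ℝ) 1) c with hγ
  have hγ0 : γ 0 = p := eq_lim_at_left_extendFrom_Ioo zero_lt_one h0
  have hγ1 : γ 1 = q := eq_lim_at_right_extendFrom_Ioo zero_lt_one h1
  have hγc : EqOn γ c (Ioo 0 1) := fun t ht ↦ extendFrom_eq
    (subset_closure ht) (hcc t ht)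
  have hγW : ∀ t ∈ Ioo (0 : ℝ) 1, γ t ∈ W := fun t ht ↦ by
    rw [hγc ht]; exact hf.mapsTo (hball t ht)
  have hpF := hf.mem_frontier_of_tendsto hp
  have hqF := hf.mem_frontier_of_tendsto hq
  have hpW := (hf.mem_frontier_iff.1 hpF).2
  have hqW := (hf.mem_frontier_iff.1 hqF).2
  refine ⟨γ, ⟨continuousOn_Icc_extendFrom_Ioo hcc h0 h1, ?_, hγW, by rwa [hγ0],
    by rwa [hγ1]⟩, hγ0, hγ1, ?_⟩
  · have hcases : ∀ t ∈ Icc (0 : ℝ) 1, t = 0 ∨ t = 1 ∨ t ∈ Ioo (0 : ℝ) 1 := fun t ht ↦ by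
      rcases ht.1.eq_or_lt with h | h
      · exact Or.inl h.symm
      rcases ht.2.eq_or_lt with h' | h'
      · exact Or.inr (Or.inl h')
      · exact Or.inr (Or.inr ⟨h, h'⟩)
    intro t ht s hs hts
    rcases hcases t ht with rfl | rfl | ht' <;> rcases hcases s hs with rfl | rfl | hs'
    · rfl
    · rw [hγ0, hγ1] at hts; exact absurd hts hpq
    · rw [hγ0] at hts; exact absurd (hγW s hs') (by rwa [← hts])
    · rw [hγ0, hγ1] at hts; exact absurd hts.symm hpq
    · rfl
    · rw [hγ1] at hts; exact absurd (hγW s hs') (by rwa [← hts])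
    · rw [hγ0] at hts; exact absurd (hγW t ht') (by rwa [hts])
    · rw [hγ1] at hts; exact absurd (hγW t ht') (by rwa [hts])
    · rw [hγc ht', hγc hs'] at hts
      exact injective_boxPath hαβ hh
        (hf.injOn_comp_exp hβα (hmem t ht') (hmem s hs') hts)
  · rw [← image_boxPath hαβ hh, image_image]
    exact image_congr hγc

end IsRiemannMap

end SmallCrosscuts

section FundamentalChains

open Set Filter Topology Metric Complex MeasureTheory
open scoped ENNReal

namespace IsRiemannMap

variable {W : Set ℂ} {w : ℂ} {f φ : ℂ → ℂ}

lemma volume_tendsto_mem_eq_zero (hf : IsRiemannMap W w f φ) (hW : Bornology.IsBounded W) (a : ℝ)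
    {Q : Set ℂ} (hQ : Q.Finite) :
    volume ({y : ℝ | ∃ q ∈ Q, q ∉ W ∧ Tendsto (fun x : ℝ ↦ f (exp (x + y * I))) (𝓝[<] 0) (𝓝 q)} ∩
      Ioo (a - 1) (a + 1)) = 0 := by
  have : {y : ℝ | ∃ q ∈ Q, q ∉ W ∧ Tendsto (fun x : ℝ ↦ f (exp (x + y * I))) (𝓝[<] 0) (𝓝 q)} ∩
      Ioo (a - 1) (a + 1) = ⋃ q ∈ Q \ W,
        {y : ℝ | Tendsto (fun x : ℝ ↦ f (exp (x + y * I))) (𝓝[<] 0) (𝓝 q)} ∩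
          Ioo (a - 1) (a + 1) := by
    ext y; simp; tauto
  rw [this, measure_biUnion_null_iff (hQ.subset sdiff_subset).countable]
  refine fun q hq ↦ ae_not_tendsto_radial hf.differentiableOn (hf.image_ball ▸ hW)
    (fun z hz h ↦ hq.2 (by rw [← h]; exact hf.mapsTo hz)) a

/-- Every boundary point of the disc is cut off by images of boxes with small boundary, whose
endpoints avoid a given finite set. -/
lemma exists_small_isCrosscut (hf : IsRiemannMap W w f φ) (hW : Bornology.IsBounded W) (a : ℝ)
    {η δ₁ : ℝ} (hη : 0 < η) (hδ₁ : 0 < δ₁) {Q : Set ℂ} (hQ : Q.Finite) :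
    ∃ α β h : ℝ, ∃ γ : ℝ → ℂ, α ∈ Ioo (a - δ₁) a ∧ β ∈ Ioo a (a + δ₁) ∧ h ∈ Ioo 0 δ₁ ∧
      β - α < 2 ∧ IsCrosscut W γ ∧
      γ '' Ioo 0 1 = (fun z ↦ f (exp z)) '' (halfBox α β h \ openBox α β h) ∧
      diam (γ '' Icc 0 1) ≤ η ∧ γ 0 ∉ Q ∧ γ 1 ∉ Q := by
  set u : ℝ × ℝ → ℝ≥0∞ := fun p ↦ ‖deriv (fun z ↦ f (exp z)) (p.1 + p.2 * I)‖ₑ with hu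
  have hum : Measurable u := ((measurable_deriv _).comp (by fun_prop)).enorm
  have hη4 : 0 < η / 4 := by positivity
  obtain ⟨δ, ⟨hδ, hδ'⟩, hα, hβ, x₀, hx₀, hx₀int⟩ :=
    exists_small_lintegral hum (hf.setLIntegral_enorm_deriv_sq_ne_top hW a) hη4 hδ₁
  have hδδ : δ < δ₁ := hδ'.trans_le (min_le_left _ _)
  have hδ1 : δ < 1 := hδ'.trans_le (min_le_right _ _)
  have hH : ∀ y : ℝ, ContDiffOn ℝ 1 (fun x : ℝ ↦ f (exp (x + y * I))) (Ioo (-δ) 0) := fun y ↦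
    hf.contDiffOn_comp_exp (c := fun x : ℝ ↦ (x : ℂ) + y * I)
      (ofRealCLM.contDiff.add contDiff_const) fun x hx ↦ by simpa using hx.2
  have hHint : ∀ y : ℝ, ∫⁻ x in Ioo (-δ) 0, u (x, y) ≤ ENNReal.ofReal (η / 4) →
      ∫⁻ x in Ioo (-δ) 0, ‖deriv (fun x : ℝ ↦ f (exp (x + y * I))) x‖ₑ
        ≤ ENNReal.ofReal (η / 4) := fun y hy ↦ by
    refine (setLIntegral_congr_fun measurableSet_Ioo fun x hx ↦ ?_).trans_le hy
    exact hf.enorm_deriv_comp_exp (c := fun x : ℝ ↦ (x : ℂ) + y * I)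
      ((hasDerivAt_id x).ofReal_comp.add_const _) (by simp) (by simpa using hx.2)
  have hV : ContDiffOn ℝ 1 (fun y : ℝ ↦ f (exp (x₀ + y * I))) (Ioo (a - δ) (a + δ)) :=
    hf.contDiffOn_comp_exp (c := fun y : ℝ ↦ (x₀ : ℂ) + y * I)
      (contDiff_const.add (ofRealCLM.contDiff.mul contDiff_const)) fun y hy ↦ by simpa using hx₀.2
  have hVint : ∫⁻ y in Ioo (a - δ) (a + δ), ‖deriv (fun y : ℝ ↦ f (exp (x₀ + y * I))) y‖ₑ
        ≤ ENNReal.ofReal (η / 4) := by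
    refine (setLIntegral_congr_fun measurableSet_Ioo fun y hy ↦ ?_).trans_le hx₀int
    refine hf.enorm_deriv_comp_exp (c := fun y : ℝ ↦ (x₀ : ℂ) + y * I) (c' := 1 * I)
      (((hasDerivAt_id y).ofReal_comp.mul_const I).const_add _) ?_ (by simpa using hx₀.2)
    rw [one_mul, ← ofReal_norm, norm_I, ENNReal.ofReal_one]
  obtain ⟨α, hαm, hαN, hαint⟩ := hα _ (hf.volume_tendsto_mem_eq_zero hW a hQ)
  obtain ⟨p, hp⟩ := exists_tendsto_of_lintegral_enorm_deriv_ne_top (neg_lt_zero.2 hδ) (hH α)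
    (ne_top_of_le_ne_top ENNReal.ofReal_ne_top (hHint α hαint))
  obtain ⟨β, hβm, hβN, hβint⟩ := hβ _ (hf.volume_tendsto_mem_eq_zero hW a (hQ.insert p))
  obtain ⟨q, hq⟩ := exists_tendsto_of_lintegral_enorm_deriv_ne_top (neg_lt_zero.2 hδ) (hH β)
    (ne_top_of_le_ne_top ENNReal.ofReal_ne_top (hHint β hβint))
  have hpW := (hf.mem_frontier_iff.1 (hf.mem_frontier_of_tendsto hp)).2
  have hqW := (hf.mem_frontier_iff.1 (hf.mem_frontier_of_tendsto hq)).2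
  have hpQ : p ∉ Q := fun h ↦ hαN ⟨p, h, hpW, hp⟩
  have hqQ : q ∉ insert p Q := fun h ↦ hβN ⟨q, h, hqW, hq⟩
  have hpi := Real.pi_gt_three
  have hβα : β - α < 2 := by linarith [hαm.1, hβm.2]
  have hαβ : α < β := hαm.2.trans hβm.1
  have hh : 0 < -x₀ := neg_pos.2 hx₀.2
  obtain ⟨γ, hγ, hγ0, hγ1, hγim⟩ := hf.exists_isCrosscut hαβ (by linarith) hh hp hq
    (fun h ↦ hqQ (h ▸ mem_insert p Q))
  refine ⟨α, β, -x₀, γ, ⟨by linarith [hαm.1], hαm.2⟩, ⟨hβm.1, by linarith [hβm.2]⟩,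
    ⟨hh, by linarith [hx₀.1]⟩, hβα, hγ, hγim, ?_, hγ0 ▸ hpQ, fun h ↦ hqQ (hγ1 ▸ Or.inr h)⟩
  have hαV : α ∈ Ioo (a - δ) (a + δ) := ⟨hαm.1, by linarith [hαm.2]⟩
  have hβV : β ∈ Ioo (a - δ) (a + δ) := ⟨by linarith [hβm.1], hβm.2⟩
  have hsub : γ '' Ioo 0 1 ⊆ closedBall (f (exp (x₀ + α * I))) (η / 2) := by
    rw [hγim]
    rintro _ ⟨z, ⟨hz, hz'⟩, rfl⟩
    simp only [mem_closedBall]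
    rw [mem_halfBox, neg_neg] at hz
    rw [mem_openBox, neg_neg] at hz'
    have hzre : z.re ∈ Ioo (-δ) 0 := ⟨hx₀.1.trans_le hz.1.1, hz.1.2⟩
    rcases hz.2.1.eq_or_lt with h1 | h1
    · have h := dist_le_of_lintegral_enorm_deriv_le hη4.le (hH α) (hHint α hαint) hzre hx₀
      rw [h1, re_add_im] at h
      rw [h1]
      linarith
    rcases hz.2.2.eq_or_lt with h2 | h2
    · have h := dist_le_of_lintegral_enorm_deriv_le hη4.le (hH β) (hHint β hβint) hzre hx₀
      have h' := dist_le_of_lintegral_enorm_deriv_le hη4.le hV hVint hβV hαV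
      rw [← h2, re_add_im, h2] at h
      have := dist_triangle (f (exp z)) (f (exp (x₀ + β * I))) (f (exp (x₀ + α * I)))
      linarith
    · have h3 : x₀ = z.re := by
        by_contra hne
        exact hz' ⟨⟨lt_of_le_of_ne hz.1.1 hne, hz.1.2⟩, h1, h2⟩
      have h := dist_le_of_lintegral_enorm_deriv_le hη4.le hV hVint
        (s := z.im) ⟨by linarith [hαm.1], by linarith [hβm.2]⟩ hαV
      have h4 : (x₀ : ℂ) + z.im * I = z := by rw [h3, re_add_im]
      rw [h4] at h
      linarith
  have hsub2 : γ '' Icc 0 1 ⊆ closedBall (f (exp (x₀ + α * I))) (η / 2) := by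
    have h := hγ.1
    rw [← closure_Ioo zero_ne_one] at h
    have h' := h.image_closure
    rw [closure_Ioo zero_ne_one] at h'
    exact h'.trans (closure_minimal hsub isClosed_closedBall)
  refine (diam_mono hsub2 isBounded_closedBall).trans ((diam_closedBall (by positivity)).trans ?_)
  linarith

end IsRiemannMap

lemma IsCrosscut.diam_pos {W : Set ℂ} {γ : ℝ → ℂ} (hγ : IsCrosscut W γ) :
    0 < diam (γ '' Icc 0 1) := by
  have h0 : (0 : ℝ) ∈ Icc (0 : ℝ) 1 := by simp
  have h1 : (1 : ℝ) ∈ Icc (0 : ℝ) 1 := by simp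
  refine (dist_pos.2 fun h ↦ zero_ne_one (hγ.2.1 h0 h1 h)).trans_le
    (dist_le_diam_of_mem (isCompact_Icc.image_of_continuousOn hγ.1).isBounded
      (mem_image_of_mem γ h0) (mem_image_of_mem γ h1))

/-- A crosscut which is the image of three sides of a box around the boundary point `a * I` of the
left half-plane. -/
structure BoxCrosscut (W : Set ℂ) (f : ℂ → ℂ) (a : ℝ) where
  left : ℝ
  right : ℝ
  depth : ℝ
  curve : ℝ → ℂ
  left_lt : left < a
  lt_right : a < right
  depth_pos : 0 < depth
  width_lt : right - left < 2
  isCrosscut : IsCrosscut W curve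
  image_curve : curve '' Ioo 0 1 =
    (fun z ↦ f (exp z)) '' (halfBox left right depth \ openBox left right depth)

namespace BoxCrosscut

variable {W : Set ℂ} {w : ℂ} {f φ : ℂ → ℂ} {a : ℝ}

/-- The crosscut `y` lies inside the crosscut `x`, is at most half as big, and has different
endpoints. -/
structure Inside (x y : BoxCrosscut W f a) : Prop where
  left_lt : x.left < y.left
  right_lt : y.right < x.right
  depth_lt : y.depth < x.depth
  diam_le : diam (y.curve '' Icc 0 1) ≤ diam (x.curve '' Icc 0 1) / 2
  curve_zero : y.curve 0 ∉ ({x.curve 0, x.curve 1} : Set ℂ)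
  curve_one : y.curve 1 ∉ ({x.curve 0, x.curve 1} : Set ℂ)

lemma Inside.halfBox_subset {x y : BoxCrosscut W f a} (h : Inside x y) :
    halfBox y.left y.right y.depth ⊆ openBox x.left x.right x.depth := fun _ hz ↦
  ⟨⟨(neg_lt_neg h.depth_lt).trans_le hz.1.1, hz.1.2⟩, h.left_lt.trans_le hz.2.1,
    hz.2.2.trans_lt h.right_lt⟩

lemma width_lt_two_pi (x : BoxCrosscut W f a) : x.right - x.left < 2 * Real.pi := by
  have := x.width_lt
  have := Real.pi_gt_three
  linarith

lemma crosscutNbhd_curve (hf : IsRiemannMap W w f φ) (x : BoxCrosscut W f a) :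
    crosscutNbhd W w x.curve = (fun z ↦ f (exp z)) '' openBox x.left x.right x.depth :=
  hf.crosscutNbhd_eq x.width_lt_two_pi x.image_curve

lemma eq_zero_or_one_or_mem {t : ℝ} (ht : t ∈ Icc (0 : ℝ) 1) :
    t = 0 ∨ t = 1 ∨ t ∈ Ioo (0 : ℝ) 1 := by
  rcases ht.1.eq_or_lt with h | h
  · exact Or.inl h.symm
  rcases ht.2.eq_or_lt with h' | h'
  · exact Or.inr (Or.inl h')
  · exact Or.inr (Or.inr ⟨h, h'⟩)

lemma Inside.disjoint (hf : IsRiemannMap W w f φ) {x y : BoxCrosscut W f a} (h : Inside x y) :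
    Disjoint (x.curve '' Icc 0 1) (y.curve '' Icc 0 1) := by
  have hWF : ∀ {p q}, p ∈ W → q ∈ frontier W → p ≠ q := fun hp hq h ↦
    (hf.mem_frontier_iff.1 hq).2 (h ▸ hp)
  have hx := x.isCrosscut.2.2
  have hy := y.isCrosscut.2.2
  have h0 := h.curve_zero
  have h1 := h.curve_one
  simp only [mem_insert_iff, mem_singleton_iff, not_or] at h0 h1
  rw [Set.disjoint_left]
  rintro _ ⟨t, ht, rfl⟩ ⟨s, hs, hst⟩
  rcases eq_zero_or_one_or_mem ht with rfl | rfl | ht' <;>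
  rcases eq_zero_or_one_or_mem hs with rfl | rfl | hs'
  · exact h0.1 hst
  · exact h1.1 hst
  · exact hWF (hy.1 s hs') hx.2.1 hst
  · exact h0.2 hst
  · exact h1.2 hst
  · exact hWF (hy.1 s hs') hx.2.2 hst
  · exact hWF (hx.1 t ht') hy.2.1 hst.symm
  · exact hWF (hx.1 t ht') hy.2.2 hst.symm
  · obtain ⟨u, hu, hut⟩ := x.image_curve.subset (mem_image_of_mem _ ht')
    obtain ⟨v, hv, hvs⟩ := y.image_curve.subset (mem_image_of_mem _ hs')
    have hv' := h.halfBox_subset hv.1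
    have huv : u = v := hf.injOn_comp_exp x.width_lt_two_pi hu.1
      (openBox_subset_halfBox _ _ _ hv') (hut.trans (hst.symm.trans hvs.symm))
    exact hu.2 (huv ▸ hv')

lemma exists_inside (hf : IsRiemannMap W w f φ) (hW : Bornology.IsBounded W)
    (s : Finset (BoxCrosscut W f a)) : ∃ y : BoxCrosscut W f a, ∀ x ∈ s, Inside x y := by
  have hev : ∀ᶠ δ : ℝ in 𝓝[>] 0, ∀ x ∈ s, δ < a - x.left ∧ δ < x.right - a ∧ δ < x.depth ∧
      δ < diam (x.curve '' Icc 0 1) / 2 := by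
    refine (eventually_all_finset s).2 fun x _ ↦ ?_
    have h : ∀ b : ℝ, 0 < b → ∀ᶠ δ : ℝ in 𝓝[>] 0, δ < b := fun b hb ↦
      nhdsWithin_le_nhds (gt_mem_nhds hb)
    exact (h _ (sub_pos.2 x.left_lt)).and ((h _ (sub_pos.2 x.lt_right)).and
      ((h _ x.depth_pos).and (h _ (half_pos x.isCrosscut.diam_pos))))
  obtain ⟨δ, hδs, hδ⟩ := (hev.and self_mem_nhdsWithin).exists
  have hδ0 : 0 < δ := hδ
  obtain ⟨α, β, h, γ, hα, hβ, hh, hαβ, hγ, hγim, hdiam, h0, h1⟩ :=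
    hf.exists_small_isCrosscut hW a hδ0 hδ0
    (Q := ⋃ x ∈ s, {x.curve 0, x.curve 1}) (s.finite_toSet.biUnion fun x _ ↦ by simp)
  refine ⟨⟨α, β, h, γ, hα.2, hβ.1, hh.1, hαβ, hγ, hγim⟩, fun x hx ↦ ?_⟩
  obtain ⟨h2, h3, h4, h5⟩ := hδs x hx
  exact ⟨by linarith [hα.1], by linarith [hβ.2], hh.2.trans h4, hdiam.trans h5.le,
    fun h ↦ h0 (mem_biUnion (Finset.mem_coe.2 hx) h), fun h ↦ h1 (mem_biUnion (Finset.mem_coe.2 hx) h)⟩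

/-- There is a fundamental chain of images of boxes shrinking to a given boundary point. -/
lemma exists_isFundamentalChain (hf : IsRiemannMap W w f φ) (hW : Bornology.IsBounded W) (a : ℝ) :
    ∃ x : ℕ → BoxCrosscut W f a, IsFundamentalChain W w fun j ↦ (x j).curve := by
  obtain ⟨x, -, hx⟩ := exists_seq_of_forall_finset_exists (fun _ : BoxCrosscut W f a ↦ True) Inside
    fun s _ ↦ (exists_inside hf hW s).imp fun y hy ↦ ⟨trivial, hy⟩
  refine ⟨x, fun j ↦ (x j).isCrosscut, fun j ↦ ?_, fun j ↦ ?_, fun i j hij ↦ ?_, ?_⟩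
  · rw [(x j).image_curve]
    exact hf.base_notMem_image fun z hz ↦ hz.1.1.2
  · rw [crosscutNbhd_curve hf, crosscutNbhd_curve hf]
    exact image_mono ((openBox_subset_halfBox _ _ _).trans (hx j _ j.lt_succ_self).halfBox_subset)
  · rcases hij.lt_or_gt with h | h
    · exact (hx i j h).disjoint hf
    · exact ((hx j i h).disjoint hf).symm
  · have hle : ∀ j, diam ((x j).curve '' Icc 0 1)
        ≤ diam ((x 0).curve '' Icc 0 1) * (1 / 2) ^ j := by
      intro j
      induction j with
      | zero => simp
      | succ j ih =>
        have := (hx j _ j.lt_succ_self).diam_le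
        rw [pow_succ]
        linarith
    refine squeeze_zero (fun _ ↦ diam_nonneg) hle ?_
    simpa using (tendsto_pow_atTop_nhds_zero_of_lt_one (r := (1 / 2 : ℝ)) (by norm_num)
      (by norm_num)).const_mul (diam ((x 0).curve '' Icc 0 1))

end BoxCrosscut

/-- If all impressions are trivial then the conformal map has limits at all boundary points. -/
lemma IsRiemannMap.exists_tendsto {W : Set ℂ} {w : ℂ} {f φ : ℂ → ℂ} (hf : IsRiemannMap W w f φ)
    (hW : Bornology.IsBounded W)
    (htriv : ∀ γ : ℕ → ℝ → ℂ, IsFundamentalChain W w γ →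
      ∃ p : ℂ, (⋂ j, closure (crosscutNbhd W w (γ j))) = {p}) {ζ : ℂ} (hζ : ‖ζ‖ = 1) :
    ∃ p, Tendsto f (𝓝[ball 0 1] ζ) (𝓝 p) := by
  set a := arg ζ with ha
  obtain ⟨x, hx⟩ := BoxCrosscut.exists_isFundamentalChain hf hW a
  obtain ⟨p, hp⟩ := htriv _ hx
  refine ⟨p, fun U hU ↦ ?_⟩
  have hsubW : ∀ j, crosscutNbhd W w (x j).curve ⊆ W := fun j z hz ↦ hz.1.1
  have hanti : Antitone fun j ↦ closure (crosscutNbhd W w (x j).curve) :=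
    antitone_nat_of_succ_le fun j ↦ closure_mono (hx.2.2.1 j)
  obtain ⟨j, hj⟩ := exists_subset_nhds_of_isCompact' hanti.directed_ge
    (fun j ↦ (hW.subset (hsubW j)).isCompact_closure) (fun j ↦ isClosed_closure)
    (U := U) fun y hy ↦ by rw [hp] at hy; rwa [mem_singleton_iff.1 hy]
  set y := x j with hy
  have hV : IsOpen (exp '' (Ioo (-y.depth) y.depth ×ℂ Ioo y.left y.right)) :=
    isOpenMap_exp _ (isOpen_Ioo.reProdIm isOpen_Ioo)
  have hζV : ζ ∈ exp '' (Ioo (-y.depth) y.depth ×ℂ Ioo y.left y.right) := by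
    refine ⟨a * I, ?_, by simpa [hζ] using norm_mul_exp_arg_mul_I ζ⟩
    rw [mem_reProdIm]
    simp [y.depth_pos, y.left_lt, y.lt_right]
  rw [mem_map]
  filter_upwards [nhdsWithin_le_nhds (hV.mem_nhds hζV), self_mem_nhdsWithin] with ξ hξ hξb
  obtain ⟨z, hz, rfl⟩ := hξ
  refine hj (subset_closure ?_)
  rw [BoxCrosscut.crosscutNbhd_curve hf]
  exact ⟨z, ⟨⟨hz.1.1, exp_mem_ball_iff.1 hξb⟩, hz.2⟩, rfl⟩

end FundamentalChains

section BoundaryExtension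

open Set Filter Topology Metric Complex

lemma Circle.locallyConnectedSpace : LocallyConnectedSpace Circle :=
  (AddCircle.homeomorphCircle'.isQuotientMap.comp
    (isQuotientMap_quotient_mk' (X := ℝ))).isCoinducing.locallyConnectedSpace

/-- If the conformal map has limits at all boundary points then its extension maps the unit
circle continuously onto the boundary, which is therefore locally connected. -/
lemma IsRiemannMap.locallyConnectedSpace_frontier {W : Set ℂ} {w : ℂ} {f φ : ℂ → ℂ}
    (hf : IsRiemannMap W w f φ)
    (hlim : ∀ ζ : ℂ, ‖ζ‖ = 1 → ∃ p, Tendsto f (𝓝[ball 0 1] ζ) (𝓝 p)) :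
    LocallyConnectedSpace (frontier W) := by
  set F := extendFrom (ball (0 : ℂ) 1) f with hF
  have hcl : closure (ball (0 : ℂ) 1) = closedBall 0 1 := closure_ball 0 one_ne_zero
  have hlim' : ∀ ζ ∈ closedBall (0 : ℂ) 1, ∃ p, Tendsto f (𝓝[ball 0 1] ζ) (𝓝 p) := by
    intro ζ hζ
    rcases (mem_closedBall_zero_iff.1 hζ).lt_or_eq with h | h
    · exact ⟨f ζ, hf.differentiableOn.continuousOn ζ (mem_ball_zero_iff.2 h)⟩
    · exact hlim ζ h
  have hFc : ContinuousOn F (closedBall 0 1) := continuousOn_extendFrom hcl.ge hlim'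
  have hFf : EqOn F f (ball 0 1) := fun ζ hζ ↦
    extendFrom_eq (subset_closure hζ) (hf.differentiableOn.continuousOn ζ hζ)
  have hFfr : ∀ ζ : ℂ, ‖ζ‖ = 1 → F ζ ∈ frontier W := by
    intro ζ hζ
    have hζc : ζ ∈ closure (ball (0 : ℂ) 1) := by rw [hcl]; simp [hζ]
    have : (𝓝[ball 0 1] ζ).NeBot := mem_closure_iff_nhdsWithin_neBot.1 hζc
    have ht : Tendsto f (𝓝[ball 0 1] ζ) (𝓝 (F ζ)) := tendsto_extendFrom (hlim ζ hζ)
    refine hf.mem_frontier_iff.2 ⟨mem_closure_of_tendsto ht ?_, fun hW ↦ ?_⟩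
    · filter_upwards [self_mem_nhdsWithin] with z hz using hf.mapsTo hz
    · have h1 : Tendsto (fun z ↦ φ (f z)) (𝓝[ball 0 1] ζ) (𝓝 (φ (F ζ))) :=
        (hf.continuousOn_inv.continuousAt (hf.isOpen.mem_nhds hW)).tendsto.comp ht
      have h2 : Tendsto (fun z ↦ φ (f z)) (𝓝[ball 0 1] ζ) (𝓝 ζ) := by
        refine (tendsto_id.mono_left nhdsWithin_le_nhds).congr' ?_
        filter_upwards [self_mem_nhdsWithin] with z hz using (hf.left_inv hz).symm
      have h3 := hf.mapsTo_inv hW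
      rw [tendsto_nhds_unique h1 h2, mem_ball_zero_iff, hζ] at h3
      exact h3.false
  have hWF : closure W ⊆ F '' closedBall 0 1 := by
    refine closure_minimal ?_ ((isCompact_closedBall 0 1).image_of_continuousOn hFc).isClosed
    rw [← hf.image_ball, ← hFf.image_eq]
    exact image_mono ball_subset_closedBall
  have hG : Continuous fun z : Circle ↦ (⟨F z, hFfr z z.norm_coe⟩ : frontier W) :=
    (hFc.comp_continuous continuous_subtype_val fun z : Circle ↦
      mem_closedBall_zero_iff.2 z.norm_coe.le).subtype_mk _
  have hGs : Function.Surjective fun z : Circle ↦ (⟨F z, hFfr z z.norm_coe⟩ : frontier W) := by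
    rintro ⟨q, hq⟩
    obtain ⟨hqc, hqW⟩ := hf.mem_frontier_iff.1 hq
    obtain ⟨ζ, hζ, rfl⟩ := hWF hqc
    rcases (mem_closedBall_zero_iff.1 hζ).lt_or_eq with h | h
    · have hζb := mem_ball_zero_iff.2 h
      exact (hqW (by rw [hFf hζb]; exact hf.mapsTo hζb)).elim
    · exact ⟨⟨ζ, mem_sphere_zero_iff_norm.2 h⟩, rfl⟩
  have := Circle.locallyConnectedSpace
  exact (hG.isClosedMap.isQuotientMap hG hGs).isCoinducing.locallyConnectedSpace

end BoundaryExtension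

/-- If the impression of every prime end of `W` is trivial, then `∂W` is locally
connected. -/
theorem locallyConnected_of_impression_trivial
    (W : Set ℂ) (hWb : Bornology.IsBounded W) (hWo : IsOpen W)
    (hWc : IsConnected W) (hWsc : SimplyConnectedSpace W)
    (w : ℂ) (hw : w ∈ W)
    (htriv : ∀ γ : ℕ → ℝ → ℂ, IsFundamentalChain W w γ →
      ∃ p : ℂ, (⋂ j, closure (crosscutNbhd W w (γ j))) = {p}) :
    LocallyConnectedSpace (frontier W) := by
  obtain ⟨f, φ, hd, hc, hm, hm', hl, hr, h0⟩ := exists_riemannMap hWb hWo hWsc hw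
  have hf : IsRiemannMap W w f φ := ⟨hWo, hd, hc, hm, hm', hl, hr, h0⟩
  exact hf.locallyConnectedSpace_frontier fun ζ hζ ↦ hf.exists_tendsto hWb htriv hζ
end
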